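/- arXiv:1207.6699 — 6 statements merged into one kernel-verified Lean document; each statement's English description precedes it below -/
import Mathlib

section
/- Let X and Y be Tychonoff spaces and suppose there is a continuous open surjection from C_p(X) onto C_p(Y). Then there exist, for every integer n ≥ 1, a topological space Z_n, a locally closed subspace B_n of Z_n, and a locally closed subspace Y_n of Y, such that: each Z_n admits a perfect finite-to-one continuous surjection onto a closed subspace of X^n; each Y_n is the image of B_n under a perfect continuous surjection; and Y = ⋃_{n≥1} Y_n. -/
/-- `Cp X` is the space `C(X, ℝ)` of continuous real-valued functions on `X`,
topologized as a subspace of the product `X → ℝ`, i.e. with the topology of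
pointwise convergence. -/
def Cp (X : Type*) [TopologicalSpace X] : Type _ := {f : X → ℝ // Continuous f}

instance (X : Type*) [TopologicalSpace X] : TopologicalSpace (Cp X) :=
  inferInstanceAs (TopologicalSpace {f : X → ℝ // Continuous f})


namespace Okunev
open Filter Topology Set

theorem sep {X : Type*} [TopologicalSpace X] [T35Space X] (K : Finset X) (C : Set X)
    (hC : IsClosed C) (h : ∀ x ∈ K, x ∉ C) :
    ∃ φ : X → ℝ, Continuous φ ∧ (∀ x, 0 ≤ φ x ∧ φ x ≤ 1) ∧ (∀ x ∈ K, φ x = 0) ∧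
      ∀ x ∈ C, φ x = 1 := by
  classical
  have h1 : ∀ x : K, ∃ f : X → unitInterval, Continuous f ∧ f x = 0 ∧ EqOn f 1 C :=
    fun x => CompletelyRegularSpace.completely_regular x.1 C hC (h x.1 x.2)
  choose f hf h0 hC1 using h1
  refine ⟨fun x => ∏ j : K, (f j x : ℝ), ?_, ?_, ?_, ?_⟩
  · exact continuous_finsetProd _ fun j _ => continuous_subtype_val.comp (hf j)
  · intro x
    exact ⟨Finset.prod_nonneg fun j _ => (f j x).2.1,
      Finset.prod_le_one (fun j _ => (f j x).2.1) fun j _ => (f j x).2.2⟩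
  · intro x hx
    refine Finset.prod_eq_zero (Finset.mem_univ ⟨x, hx⟩) ?_
    rw [h0]; rfl
  · intro x hx
    refine Finset.prod_eq_one fun j _ => ?_
    rw [hC1 j hx]; rfl

theorem nbhd {X : Type*} [TopologicalSpace X] (f : Cp X) (W : Set (Cp X)) (hW : IsOpen W)
    (hf : f ∈ W) : ∃ (K : Finset X) (ε : ℝ), 0 < ε ∧
      ∀ g : Cp X, (∀ x ∈ K, |g.1 x - f.1 x| < ε) → g ∈ W := by
  obtain ⟨V, hV, rfl⟩ := isOpen_induced_iff.1 hW
  obtain ⟨I, u, hu, hs⟩ := isOpen_pi_iff.1 hV f.1 hf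
  have : ∀ᶠ ε in 𝓝[>] (0 : ℝ), ∀ a ∈ I, Metric.ball (f.1 a) ε ⊆ u a := by
    rw [Filter.eventually_all_finset]
    intro a ha
    obtain ⟨ε, hε, h⟩ := Metric.isOpen_iff.1 (hu a ha).1 _ (hu a ha).2
    filter_upwards [Ioo_mem_nhdsGT hε] with e he
    exact (Metric.ball_subset_ball he.2.le).trans h
  obtain ⟨ε, h1, h2⟩ := (this.and self_mem_nhdsWithin).exists
  refine ⟨I, ε, h2, fun g hg => hs ?_⟩
  intro a ha
  exact h1 a ha (by simpa [Real.dist_eq] using hg a ha)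

theorem evalCont {X : Type*} [TopologicalSpace X] (x : X) : Continuous fun f : Cp X => f.1 x :=
  (continuous_apply x).comp continuous_subtype_val

section
variable {X : Type u} {Y : Type v} [TopologicalSpace X] [TopologicalSpace Y]

/-- the basic deviation -/
def dev (Φ : Cp X → Cp Y) (f : Cp X) (y : Y) : ℝ :=
  |(Φ f).1 y - (Φ ⟨fun _ => 0, continuous_const⟩).1 y|

theorem dev_cont (Φ : Cp X → Cp Y) (f : Cp X) : Continuous (dev Φ f) :=
  ((Φ f).2.sub (Φ _).2).abs

/-- support relation -/
def M (Φ : Cp X → Cp Y) (k : ℕ) (δ : ℝ) : Set ((Fin k → X) × Y) :=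
  {z | ∀ f : Cp X, (∀ i, |f.1 (z.1 i)| < δ) → dev Φ f z.2 ≤ 1}

/-- ultrafilter support relation -/
def S (Φ : Cp X → Cp Y) (k : ℕ) (δ : ℝ) : Set ((Fin k → Ultrafilter X) × Y) :=
  {z | ∀ f : Cp X, (∀ i, ∃ d < δ, {x | |f.1 x| ≤ d} ∈ z.1 i) → dev Φ f z.2 ≤ 1}

/-- the set of points with supports of size k -/
def T (Φ : Cp X → Cp Y) (k : ℕ) (δ : ℝ) : Set Y := Prod.snd '' S Φ k δ

theorem M_closed (Φ : Cp X → Cp Y) (k : ℕ) (δ : ℝ) : IsClosed (M Φ k δ) := by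
  have : M Φ k δ = ⋂ f : Cp X, {z | (∀ i, |f.1 (z.1 i)| < δ) → dev Φ f z.2 ≤ 1} := by
    ext z; simp [M]
  rw [this]
  refine isClosed_iInter fun f => isClosed_imp ?_ ?_
  · simp only [ofPred_forall]
    refine isOpen_iInter_of_finite fun i => ?_
    exact isOpen_lt ((f.2.comp ((continuous_apply i).comp continuous_fst)).abs) continuous_const
  · exact isClosed_le ((dev_cont Φ f).comp continuous_snd) continuous_const

theorem S_closed (Φ : Cp X → Cp Y) (k : ℕ) (δ : ℝ) : IsClosed (S Φ k δ) := by
  have : S Φ k δ = ⋂ f : Cp X, {z | (∀ i, ∃ d < δ, {x | |f.1 x| ≤ d} ∈ z.1 i) →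
      dev Φ f z.2 ≤ 1} := by
    ext z; simp [S]
  rw [this]
  refine isClosed_iInter fun f => isClosed_imp ?_ ?_
  · simp only [ofPred_forall]
    refine isOpen_iInter_of_finite fun i => ?_
    have h : {z : (Fin k → Ultrafilter X) × Y | ∃ d < δ, {x | |f.1 x| ≤ d} ∈ z.1 i} =
        ⋃ d : ℝ, ⋃ (_ : d < δ), (fun z : (Fin k → Ultrafilter X) × Y => z.1 i) ⁻¹'
          {u | {x | |f.1 x| ≤ d} ∈ u} := by
      ext z; simp
    rw [h]
    refine isOpen_iUnion fun d => isOpen_iUnion fun _ => ?_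
    exact (ultrafilter_isOpen_basic _).preimage ((continuous_apply i).comp continuous_fst)
  · exact isClosed_le ((dev_cont Φ f).comp continuous_snd) continuous_const

theorem T_closed (Φ : Cp X → Cp Y) (k : ℕ) (δ : ℝ) : IsClosed (T Φ k δ) :=
  isClosedMap_snd_of_compactSpace _ (S_closed Φ k δ)

theorem T_zero (Φ : Cp X → Cp Y) (hs : Function.Surjective Φ) (δ : ℝ) (y : Y) :
    y ∉ T Φ 0 δ := by
  rintro ⟨z, hz, rfl⟩
  obtain ⟨f, hf⟩ := hs ⟨fun y => (Φ ⟨fun _ => 0, continuous_const⟩).1 y + 2,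
    (Φ _).2.add continuous_const⟩
  have := hz f (fun i => i.elim0)
  rw [dev, hf] at this
  norm_num at this

theorem T_union (Φ : Cp X → Cp Y) (hc : Continuous Φ) (y : Y) :
    ∃ (k b : ℕ), 1 ≤ b ∧ y ∈ T Φ k (1 / ((b : ℝ) + 1)) := by
  obtain ⟨K, ε, hε, h⟩ := nbhd (⟨fun _ => 0, continuous_const⟩ : Cp X)
    {f | dev Φ f y < 1} (isOpen_lt
      ((((evalCont y).comp hc).sub continuous_const).abs) continuous_const) (by
        change dev Φ _ y < 1; simp [dev])
  obtain ⟨b, hb⟩ := exists_nat_one_div_lt hε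
  refine ⟨K.card, b + 1, by omega, ⟨(fun i => pure (K.equivFin.symm i).1, y), ?_, rfl⟩⟩
  intro f hf
  refine (h f ?_).le
  intro x hx
  obtain ⟨d, hd, hm⟩ := hf (K.equivFin ⟨x, hx⟩)
  simp only [Equiv.symm_apply_apply, Ultrafilter.mem_pure, mem_ofPred_eq] at hm
  simp only [sub_zero]
  refine (hm.trans_lt hd).trans (lt_trans ?_ hb)
  push_cast
  apply one_div_lt_one_div_of_lt <;> [positivity; linarith]

theorem S_conv [T35Space X] (Φ : Cp X → Cp Y) (hc : Continuous Φ) (k : ℕ) (δ : ℝ) (hδ : 0 < δ)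
    (u : Fin (k + 1) → Ultrafilter X) (y : Y) (hu : (u, y) ∈ S Φ (k + 1) δ)
    (hy : y ∉ T Φ k δ) (i : Fin (k + 1)) : ∃ x, (u i : Filter X) ≤ 𝓝 x := by
  classical
  by_contra! hn
  refine hy ⟨(fun j => u (i.succAbove j), y), ?_, rfl⟩
  intro f hf
  by_contra! hlt
  obtain ⟨K, ε, hε, h⟩ := nbhd f {f | 1 < dev Φ f y} (isOpen_lt continuous_const
      ((((evalCont y).comp hc).sub continuous_const).abs)) hlt
  have h1 : ∀ x, ∃ V : Set X, IsOpen V ∧ x ∈ V ∧ Vᶜ ∈ u i := by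
    intro x
    have := hn x
    rw [(nhds_basis_opens x).ge_iff] at this
    push Not at this
    obtain ⟨V, hV, hV2⟩ := this
    exact ⟨V, hV.2, hV.1, Ultrafilter.compl_mem_iff_notMem.2 hV2⟩
  choose V hVo hxV hVu using h1
  obtain ⟨φ, hφ, hb, h0, hC⟩ := sep K (⋂ x ∈ K, (V x)ᶜ)
    (isClosed_biInter fun x _ => (hVo x).isClosed_compl)
    (fun x hx hm => (mem_iInter₂.1 hm x hx) (hxV x))
  have hmem : (⋂ x ∈ K, (V x)ᶜ) ∈ (u i : Filter X) :=
    (Filter.biInter_finset_mem K).2 fun x _ => hVu x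
  let g : Cp X := ⟨fun x => f.1 x * (1 - φ x), f.2.mul (continuous_const.sub hφ)⟩
  have hg : 1 < dev Φ g y := h g fun x hx => by simp [g, h0 x hx, hε]
  refine hg.not_ge (hu g fun j => ?_)
  rcases eq_or_ne j i with rfl | hji
  · refine ⟨0, hδ, ?_⟩
    filter_upwards [hmem] with x hx
    simp [g, hC x hx]
  · obtain ⟨j', rfl⟩ := Fin.exists_succAbove_eq hji
    obtain ⟨d, hd, hm⟩ := hf j'
    refine ⟨d, hd, ?_⟩
    filter_upwards [hm] with x hx
    refine le_trans ?_ hx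
    simp only [g, abs_mul]
    refine mul_le_of_le_one_right (abs_nonneg _) ?_
    rw [abs_le]; constructor <;> linarith [(hb x).1, (hb x).2]

theorem S_to_M (Φ : Cp X → Cp Y) (k : ℕ) (δ : ℝ)
    (u : Fin k → Ultrafilter X) (y : Y) (hu : (u, y) ∈ S Φ k δ)
    (x : Fin k → X) (hx : ∀ i, (u i : Filter X) ≤ 𝓝 (x i)) : (x, y) ∈ M Φ k δ := by
  intro f hf
  refine hu f fun i => ?_
  obtain ⟨d, h1, h2⟩ := exists_between (hf i)
  refine ⟨d, h2, hx i ?_⟩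
  filter_upwards [(isOpen_lt f.2.abs continuous_const).mem_nhds h1] with x hx
  exact le_of_lt hx

theorem key [T35Space Y] (Φ : Cp X → Cp Y) (ho : IsOpenMap Φ) (k : ℕ) (δ : ℝ) (hδ : 0 < δ)
    (x : Fin k → X) : ∃ K : Finset Y, ∀ C : Set Y, IsClosed C → (∀ y ∈ K, y ∉ C) →
      ∃ f : Cp X, (∀ i, |f.1 (x i)| < δ) ∧ ∀ y ∈ C, 1 < dev Φ f y := by
  have hU : IsOpen {f : Cp X | ∀ i, |f.1 (x i)| < δ} := by
    simp only [ofPred_forall]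
    exact isOpen_iInter_of_finite fun i => isOpen_lt (evalCont (x i)).abs continuous_const
  obtain ⟨K, ε, hε, h⟩ := nbhd (Φ ⟨fun _ => 0, continuous_const⟩) _ (ho _ hU)
    ⟨_, (fun i => by simpa using hδ : ∀ i, |(⟨fun _ => 0, continuous_const⟩ : Cp X).1 (x i)| < δ), rfl⟩
  refine ⟨K, fun C hC hK => ?_⟩
  obtain ⟨φ, hφ, hb, h0, h1⟩ := sep K C hC hK
  obtain ⟨f, hf, hfe⟩ := h ⟨fun y => (Φ ⟨fun _ => 0, continuous_const⟩).1 y + 2 * φ y,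
    (Φ _).2.add (continuous_const.mul hφ)⟩ (fun y hy => by simp [h0 y hy, hε])
  refine ⟨f, hf, fun y hy => ?_⟩
  rw [dev, hfe]
  simp [h1 y hy]

theorem M_fib [T35Space Y] (Φ : Cp X → Cp Y) (ho : IsOpenMap Φ) (k : ℕ) (δ : ℝ) (hδ : 0 < δ)
    (x : Fin k → X) : {z : M Φ k δ | z.1.1 = x}.Finite := by
  obtain ⟨K, hK⟩ := key Φ ho k δ hδ x
  refine Set.Finite.of_finite_image (f := fun z : M Φ k δ => z.1.2)
    (K.finite_toSet.subset ?_) ?_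
  · rintro _ ⟨z, rfl, rfl⟩
    by_contra hn
    obtain ⟨f, hf, h⟩ := hK {z.1.2} isClosed_singleton (fun y hy he => hn (by
      rw [mem_singleton_iff] at he; subst he; exact hy))
    exact (h _ rfl).not_ge (z.2 f hf)
  · intro z hz w hw h
    exact Subtype.ext (Prod.ext (Eq.trans hz (Eq.symm hw)) h)

theorem M_proper [T35Space Y] (Φ : Cp X → Cp Y) (ho : IsOpenMap Φ) (k : ℕ) (δ : ℝ) (hδ : 0 < δ) :
    IsProperMap (fun z : M Φ k δ => z.1.1) := by
  classical
  rw [isProperMap_iff_ultrafilter]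
  refine ⟨continuous_fst.comp continuous_subtype_val, fun 𝒰 x hx => ?_⟩
  obtain ⟨K, hK⟩ := key Φ ho k δ hδ x
  have : ∃ y ∈ K, Tendsto (fun z : M Φ k δ => z.1.2) 𝒰 (𝓝 y) := by
    by_contra! hn
    have h1 : ∀ y : Y, ∃ V : Set Y, IsOpen V ∧ y ∈ V ∧
        (y ∈ K → ∀ᶠ z : M Φ k δ in 𝒰, z.1.2 ∈ Vᶜ) := by
      intro y
      by_cases hy : y ∈ K
      · have := hn y hy
        rw [(nhds_basis_opens y).tendsto_right_iff] at this
        push Not at this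
        obtain ⟨V, hV, hV2⟩ := this
        exact ⟨V, hV.2, hV.1, fun _ => hV2⟩
      · exact ⟨univ, isOpen_univ, mem_univ _, fun h => absurd h hy⟩
    choose V hVo hxV hVu using h1
    obtain ⟨f, hf, h⟩ := hK (⋂ y ∈ K, (V y)ᶜ)
      (isClosed_biInter fun x _ => (hVo x).isClosed_compl)
      (fun x hx hm => (mem_iInter₂.1 hm x hx) (hxV x))
    have h2 : ∀ᶠ z : M Φ k δ in 𝒰, ∀ y ∈ K, z.1.2 ∈ (V y)ᶜ :=
      (Filter.eventually_all_finset K).2 fun y hy => hVu y hy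
    have h3 : ∀ᶠ z : M Φ k δ in 𝒰, ∀ i, |f.1 (z.1.1 i)| < δ := by
      rw [Filter.eventually_all]
      intro i
      have ht : Tendsto (fun z : M Φ k δ => |f.1 (z.1.1 i)|) 𝒰 (𝓝 |f.1 (x i)|) :=
        ((f.2.comp (continuous_apply (A := fun _ => X) i)).abs.tendsto x).comp hx
      exact ht.eventually_lt_const (hf i)
    obtain ⟨z, h2, h3⟩ := (h2.and h3).exists
    exact (h z.1.2 (mem_iInter₂.2 h2)).not_ge (z.2 f h3)
  obtain ⟨y, -, hy⟩ := this
  have ht : Tendsto (fun z : M Φ k δ => z.1) 𝒰 (𝓝 (x, y)) := hx.prodMk_nhds hy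
  have hm : (x, y) ∈ M Φ k δ :=
    (M_closed Φ k δ).mem_of_tendsto ht (Eventually.of_forall fun z => z.2)
  refine ⟨⟨(x, y), hm⟩, rfl, ?_⟩
  rw [nhds_subtype_eq_comap]
  exact tendsto_iff_comap.1 ht

/-- the pieces of Y -/
def Yp (Φ : Cp X → Cp Y) (k : ℕ) (δ : ℝ) : Set Y := T Φ (k + 1) δ \ T Φ k δ

theorem Yp_lc (Φ : Cp X → Cp Y) (k : ℕ) (δ : ℝ) : IsLocallyClosed (Yp Φ k δ) :=
  (T_closed Φ _ δ).isLocallyClosed.inter (T_closed Φ _ δ).isOpen_compl.isLocallyClosed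

/-- the piece of the support relation -/
def Bp (Φ : Cp X → Cp Y) (k : ℕ) (δ : ℝ) : Set (M Φ (k + 1) δ) := {z | z.1.2 ∈ Yp Φ k δ}

theorem B_proper [T35Space X] (Φ : Cp X → Cp Y) (hc : Continuous Φ) (k : ℕ) (δ : ℝ)
    (hδ : 0 < δ) :
    IsProperMap (fun z : Bp Φ k δ => (⟨z.1.1.2, z.2⟩ : Yp Φ k δ)) := by
  rw [isProperMap_iff_ultrafilter]
  refine ⟨(continuous_snd.comp (continuous_subtype_val.comp continuous_subtype_val)).subtype_mk _,
    fun 𝒰 y hy => ?_⟩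
  have hy' : Tendsto (fun z : Bp Φ k δ => z.1.1.2) 𝒰 (𝓝 y.1) :=
    (continuous_subtype_val.tendsto y).comp hy
  let u : Fin (k + 1) → Ultrafilter X := fun i => 𝒰.map fun z => z.1.1.1 i
  have hu : (u, y.1) ∈ S Φ (k + 1) δ := by
    intro f hf
    by_contra! hlt
    have h1 : ∀ᶠ z : Bp Φ k δ in 𝒰, 1 < dev Φ f z.1.1.2 :=
      (((dev_cont Φ f).tendsto y.1).comp hy').eventually_const_lt hlt
    have h2 : ∀ᶠ z : Bp Φ k δ in 𝒰, ∀ i, |f.1 (z.1.1.1 i)| < δ := by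
      rw [Filter.eventually_all]
      intro i
      obtain ⟨d, hd, hm⟩ := hf i
      have hm' : ∀ᶠ z : Bp Φ k δ in 𝒰, |f.1 (z.1.1.1 i)| ≤ d := hm
      exact hm'.mono fun z hz => hz.trans_lt hd
    obtain ⟨z, h1, h2⟩ := (h1.and h2).exists
    exact h1.not_ge (z.1.2 f h2)
  choose x hx using S_conv Φ hc k δ hδ u y.1 hu y.2.2
  have hm := S_to_M Φ _ δ u y.1 hu x hx
  refine ⟨⟨⟨(x, y.1), hm⟩, y.2⟩, rfl, ?_⟩
  have ht : Tendsto (fun z : Bp Φ k δ => z.1.1) 𝒰 (𝓝 (x, y.1)) :=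
    (tendsto_pi_nhds.2 fun i => hx i : Tendsto (fun z : Bp Φ k δ => z.1.1.1) 𝒰 (𝓝 x)).prodMk_nhds
      hy'
  have hemb : Topology.IsInducing (fun z : Bp Φ k δ => z.1.1) :=
    Topology.IsInducing.subtypeVal.comp Topology.IsInducing.subtypeVal
  rw [hemb.nhds_eq_comap]
  exact tendsto_iff_comap.1 ht

theorem B_surj [T35Space X] (Φ : Cp X → Cp Y) (hc : Continuous Φ) (k : ℕ) (δ : ℝ)
    (hδ : 0 < δ) :
    Function.Surjective (fun z : Bp Φ k δ => (⟨z.1.1.2, z.2⟩ : Yp Φ k δ)) := by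
  rintro ⟨y, hy⟩
  obtain ⟨⟨u, y⟩, hu, rfl⟩ := hy.1
  choose x hx using S_conv Φ hc k δ hδ u y hu hy.2
  exact ⟨⟨⟨(x, y), S_to_M Φ _ δ u y hu x hx⟩, hy⟩, rfl⟩

theorem Z_part [T35Space X] [T35Space Y] (Φ : Cp X → Cp Y) (ho : IsOpenMap Φ) (k n : ℕ)
    (hk : k + 1 ≤ n) (δ : ℝ) (hδ : 0 < δ) :
    ∃ F : Set (Fin n → X), IsClosed F ∧
        ∃ p : M Φ (k + 1) δ → ↥F, Continuous p ∧ Function.Surjective p ∧ IsClosedMap p ∧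
          (∀ b, IsCompact (p ⁻¹' {b})) ∧ (∀ b, (p ⁻¹' {b}).Finite) := by
  let e : (Fin (k + 1) → X) → (Fin n → X) := fun x i => x ⟨min i k, by omega⟩
  let s : (Fin n → X) → (Fin (k + 1) → X) := fun x i => x ⟨i, by omega⟩
  have hse : Function.LeftInverse s e := by
    intro x; funext i
    simp only [s, e]
    congr 1
    ext
    simp only
    omega
  have he : IsProperMap e := (hse.isClosedEmbedding
    (continuous_pi fun i => continuous_apply _)
    (continuous_pi fun i => continuous_apply _)).isProperMap
  have hq := he.comp (M_proper Φ ho (k + 1) δ hδ)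
  have hfin : ∀ b, ((rangeFactorization (e ∘ fun z : M Φ (k + 1) δ => z.1.1)) ⁻¹' {b}).Finite := by
    rintro ⟨b, hb⟩
    refine (M_fib Φ ho (k + 1) δ hδ (s b)).subset ?_
    intro z hz
    have : e z.1.1 = b := congrArg Subtype.val hz
    rw [mem_ofPred_eq, ← this, hse]
  refine ⟨range (e ∘ fun z : M Φ (k + 1) δ => z.1.1), hq.isClosedMap.isClosed_range,
    rangeFactorization _, hq.continuous.subtype_mk _, rangeFactorization_surjective, ?_,
    fun b => (hfin b).isCompact, hfin⟩
  intro C hC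
  have : rangeFactorization (e ∘ fun z : M Φ (k + 1) δ => z.1.1) '' C =
      Subtype.val ⁻¹' ((e ∘ fun z : M Φ (k + 1) δ => z.1.1) '' C) := by
    ext b
    simp only [mem_image, mem_preimage, Subtype.ext_iff]
    rfl
  rw [this]
  exact (hq.isClosedMap _ hC).preimage continuous_subtype_val

end
end Okunev

/-- Okunev's theorem: if there is a continuous open surjection from `C_p(X)` onto
`C_p(Y)` (for Tychonoff `X`, `Y`), then there are spaces `Z n`, locally closed
subspaces `B n ⊆ Z n` and locally closed subspaces `Yn n ⊆ Y` (for `n ≥ 1`) such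
that each `Z n` admits a perfect finite-to-one continuous surjection onto a closed
subspace of `X^n`, each `Yn n` is the image of `B n` under a perfect continuous
surjection, and `Y = ⋃_{n ≥ 1} Yn n`. -/
theorem okunev_theorem {X : Type u} {Y : Type v}
    [TopologicalSpace X] [TopologicalSpace Y] [T35Space X] [T35Space Y]
    (hΦ : ∃ Φ : Cp X → Cp Y, Continuous Φ ∧ IsOpenMap Φ ∧ Function.Surjective Φ) :
    ∃ (Z : ℕ → Type (max u v)) (_ : ∀ n, TopologicalSpace (Z n))
      (B : ∀ n, Set (Z n)) (Yn : ℕ → Set Y),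
      (∀ n, 1 ≤ n → IsLocallyClosed (B n)) ∧
      (∀ n, 1 ≤ n → IsLocallyClosed (Yn n)) ∧
      (∀ n, 1 ≤ n → ∃ F : Set (Fin n → X), IsClosed F ∧
        ∃ p : Z n → ↥F, Continuous p ∧ Function.Surjective p ∧ IsClosedMap p ∧
          (∀ b, IsCompact (p ⁻¹' {b})) ∧ (∀ b, (p ⁻¹' {b}).Finite)) ∧
      (∀ n, 1 ≤ n → ∃ r : ↥(B n) → ↥(Yn n), Continuous r ∧ Function.Surjective r ∧
        IsClosedMap r ∧ (∀ b, IsCompact (r ⁻¹' {b}))) ∧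
      (⋃ n, ⋃ (_ : 1 ≤ n), Yn n) = Set.univ := by
  classical
  obtain ⟨Φ, hc, ho, hs⟩ := hΦ
  have hδ : ∀ n : ℕ, (0 : ℝ) < 1 / (((Nat.unpair n).2 : ℝ) + 1) := fun n => by positivity
  refine ⟨fun n => Okunev.M Φ ((Nat.unpair n).1 + 1) (1 / (((Nat.unpair n).2 : ℝ) + 1)),
    fun n => inferInstance,
    fun n => Okunev.Bp Φ (Nat.unpair n).1 (1 / (((Nat.unpair n).2 : ℝ) + 1)),
    fun n => Okunev.Yp Φ (Nat.unpair n).1 (1 / (((Nat.unpair n).2 : ℝ) + 1)), ?_, ?_, ?_, ?_, ?_⟩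
  · intro n _
    exact (Okunev.Yp_lc Φ _ _).preimage (continuous_snd.comp continuous_subtype_val)
  · intro n _
    exact Okunev.Yp_lc Φ _ _
  · intro n hn
    exact Okunev.Z_part Φ ho _ n (Nat.unpair_lt hn) _ (hδ n)
  · intro n _
    have h := Okunev.B_proper Φ hc (Nat.unpair n).1 _ (hδ n)
    exact ⟨_, h.continuous, Okunev.B_surj Φ hc _ _ (hδ n), h.isClosedMap,
      fun b => h.isCompact_preimage isCompact_singleton⟩
  · refine Set.eq_univ_of_forall fun y => ?_
    obtain ⟨k, b, hb, hy⟩ := Okunev.T_union Φ hc y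
    have hex : ∃ k, y ∈ Okunev.T Φ k (1 / ((b : ℝ) + 1)) := ⟨k, hy⟩
    have h1 := Nat.find_spec hex
    obtain ⟨a, ha⟩ : ∃ a, Nat.find hex = a + 1 := by
      apply Nat.exists_eq_succ_of_ne_zero
      intro h0
      rw [h0] at h1
      exact Okunev.T_zero Φ hs _ y h1
    have h2 := Nat.find_min hex (m := a) (by omega)
    rw [ha] at h1
    refine Set.mem_iUnion₂.2 ⟨Nat.pair a b, hb.trans (Nat.right_le_pair a b), ?_⟩
    simp only [Nat.unpair_pair]
    exact ⟨h1, h2⟩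
end

section
/- Let X be a set, let n ≥ 1 be a natural number, and let 𝒜 be an infinite collection of subsets of X each of cardinality at most n. Then there exist a subset A₀ ⊆ X with |A₀| < n and a sequence A₁, A₂, A₃, … of pairwise distinct elements of 𝒜 such that for all distinct i, j ≥ 1 one has A_i ∩ A_j = A₀. -/
/-- A version of the Δ-system lemma: if `𝒜` is an infinite collection of subsets of `X`,
each of cardinality at most `n` (with `n ≥ 1`), then there is a set `A₀ ⊆ X` with
`|A₀| < n` and a sequence of pairwise distinct members of `𝒜` any two distinct ones of
which intersect exactly in `A₀`. -/
theorem delta_system_lemma_version {X : Type*} {n : ℕ} (hn : 1 ≤ n)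
    (𝒜 : Set (Set X)) (h𝒜inf : 𝒜.Infinite)
    (h𝒜card : ∀ A ∈ 𝒜, A.Finite ∧ A.ncard ≤ n) :
    ∃ A₀ : Set X, A₀.Finite ∧ A₀.ncard < n ∧
      ∃ f : ℕ → Set X, (∀ i, f i ∈ 𝒜) ∧ Function.Injective f ∧
        ∀ i j, i ≠ j → f i ∩ f j = A₀ := by
  classical
  let Q : ℕ → Prop := fun k => ∃ S : Finset X, S.card = k ∧ {A ∈ 𝒜 | (S : Set X) ⊆ A}.Infinite
  have hQ0 : Q 0 := ⟨∅, rfl, by simpa using h𝒜inf⟩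
  have hQn : ∀ k, Q k → k ≤ n := by
    rintro k ⟨S, rfl, hS⟩
    obtain ⟨A, hA, hSA⟩ := hS.nonempty
    have h1 := Set.ncard_le_ncard hSA (h𝒜card A hA).1
    rw [Set.ncard_coe_finset] at h1
    exact h1.trans (h𝒜card A hA).2
  obtain ⟨S, hScard, hS⟩ : Q (Nat.findGreatest Q n) := Nat.findGreatest_spec (Nat.zero_le n) hQ0
  have hmax : ∀ x, x ∉ S → {A ∈ 𝒜 | ((insert x S : Finset X) : Set X) ⊆ A}.Finite := by
    intro x hx
    by_contra hinf
    have hq : Q (S.card + 1) := ⟨insert x S, Finset.card_insert_of_notMem hx, hinf⟩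
    have := Nat.le_findGreatest (hQn _ hq) hq
    omega
  obtain ⟨f, hf, hr⟩ := exists_seq_of_forall_finset_exists
    (fun A : Set X => A ∈ 𝒜 ∧ (S : Set X) ⊆ A) (fun A B => A ≠ B ∧ A ∩ B = (S : Set X)) (by
      intro s hs
      have hU : ((⋃ A ∈ s, A) \ (S : Set X)).Finite :=
        (Set.Finite.biUnion s.finite_toSet (fun A hA => (h𝒜card A (hs A hA).1).1)).subset
          Set.diff_subset
      have hB : (⋃ x ∈ ((⋃ A ∈ s, A) \ (S : Set X)),
          {A ∈ 𝒜 | ((insert x S : Finset X) : Set X) ⊆ A}).Finite :=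
        Set.Finite.biUnion hU (fun x hx => hmax x (by simpa using hx.2))
      obtain ⟨y, ⟨hy, hSy⟩, hyB⟩ := (hS.diff (hB.union s.finite_toSet)).nonempty
      refine ⟨y, ⟨hy, hSy⟩, fun A hA => ⟨?_, ?_⟩⟩
      · rintro rfl
        exact hyB (Or.inr hA)
      · apply Set.Subset.antisymm
        · rintro x ⟨hxA, hxy⟩
          by_contra hxS
          apply hyB
          left
          refine Set.mem_biUnion (x := x) ⟨Set.mem_biUnion (x := A) hA hxA, hxS⟩ ⟨hy, ?_⟩
          rw [Finset.coe_insert]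
          exact Set.insert_subset hxy hSy
        · exact Set.subset_inter (hs A hA).2 hSy)
  have hne : ∀ i j, i ≠ j → f i ≠ f j ∧ f i ∩ f j = (S : Set X) := by
    intro i j hij
    rcases lt_or_gt_of_ne hij with h | h
    · exact hr i j h
    · exact ⟨(hr j i h).1.symm, by rw [Set.inter_comm]; exact (hr j i h).2⟩
  refine ⟨S, S.finite_toSet, ?_, f, fun i => (hf i).1, ?_, fun i j h => (hne i j h).2⟩
  · have key : ∀ i, (S : Set X) ≠ f i → (S : Set X).ncard < n := fun i h =>
      (Set.ncard_lt_ncard ((hf i).2.ssubset_of_ne h) (h𝒜card _ (hf i).1).1).trans_le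
        (h𝒜card _ (hf i).1).2
    by_cases h : (S : Set X) = f 0
    · exact key 1 (fun h1 => (hne 0 1 (by norm_num)).1 (h.symm.trans h1))
    · exact key 0 h
  · intro i j h
    by_contra hij
    exact (hne i j hij).1 h
end

section
/- Let X and Y be Tychonoff spaces, let Φ : C_p(X) → C_p(Y) be a continuous open surjection taking the zero function on X to the zero function on Y, and fix integers m ≥ 1 and n ≥ 1 and a point y ∈ Y. For a finite subset A ⊆ X and ε > 0 put O_X(A; ε) = {f ∈ C_p(X) : |f(x)| < ε for all x ∈ A}, and put Ō_Y(y; 1) = {g ∈ C_p(Y) : |g(y)| ≤ 1}. Suppose that there is NO finite set A ⊆ X with |A| ≤ n − 1 and Φ(O_X(A; 1/m)) ⊆ Ō_Y(y; 1). Then the collection {A : A a finite subset of X, |A| ≤ n, and Φ(O_X(A; 1/m)) ⊆ Ō_Y(y; 1)} is finite. -/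
theorem cp_separate {X : Type*} [TopologicalSpace X] [T35Space X] (B C : Finset X)
    (h : Disjoint B C) : ∃ g : X → ℝ, Continuous g ∧ (∀ x ∈ B, g x = 0) ∧ ∀ x ∈ C, g x = 1 := by
  classical
  have key : ∀ b : X, ∃ g : X → ℝ, Continuous g ∧ (b ∈ B → g b = 0) ∧ ∀ x ∈ C, g x = 1 := by
    intro b
    by_cases hb : b ∈ B
    · have hbC : b ∉ (C : Set X) := fun hc => Finset.disjoint_left.mp h hb (by simpa using hc)
      obtain ⟨f, hf, h0, h1⟩ := CompletelyRegularSpace.completely_regular b (C : Set X)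
        C.finite_toSet.isClosed hbC
      refine ⟨fun x => (f x : ℝ), by fun_prop, fun _ => by simp [h0], fun x hx => ?_⟩
      have := h1 (show x ∈ (C : Set X) from hx)
      simp [this]
    · exact ⟨fun _ => 1, continuous_const, fun h => absurd h hb, fun _ _ => rfl⟩
  choose g hg h0 h1 using key
  refine ⟨fun x => ∏ b ∈ B, g b x, by fun_prop, fun x hx => ?_, fun x hx => ?_⟩
  · exact Finset.prod_eq_zero hx (h0 x hx)
  · exact Finset.prod_eq_one fun b _ => h1 b x hx

theorem cp_root {X : Type*} [DecidableEq X] (S : Set (Finset X)) (n : ℕ)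
    (hn : ∀ A ∈ S, A.card ≤ n) (hS : S.Infinite) :
    ∃ R : Finset X, R.card < n ∧ ∀ F : Finset X, ∃ A ∈ S, R ⊆ A ∧ Disjoint (A \ R) F := by
  let P : ℕ → Prop := fun k => ∃ R : Finset X, R.card = k ∧ {A ∈ S | R ⊆ A}.Infinite
  have hP0 : P 0 := ⟨∅, rfl, by simpa using hS⟩
  have hb : ∀ k, P k → k < n := by
    rintro k ⟨R, rfl, hR⟩
    by_contra hk
    refine hR ((Set.finite_singleton R).subset ?_)
    rintro A ⟨hA, hRA⟩
    have := hn A hA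
    exact (Finset.eq_of_subset_of_card_le hRA (by omega)).symm
  classical
  have hk := Nat.findGreatest_spec (P := P) (Nat.zero_le n) hP0
  set k := Nat.findGreatest P n with hkdef
  obtain ⟨R, hRk, hR⟩ := hk
  refine ⟨R, hRk ▸ hb k ⟨R, hRk, hR⟩, fun F => ?_⟩
  by_contra hcon
  push Not at hcon
  refine hR (Set.Finite.subset (s := ⋃ x ∈ F \ R, {A ∈ S | insert x R ⊆ A}) ?_ ?_)
  · refine Set.Finite.biUnion (Finset.finite_toSet _) fun x hx => ?_
    by_contra hinf
    have hxR : x ∉ R := (Finset.mem_sdiff.mp hx).2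
    have hP : P (k + 1) := ⟨insert x R, by rw [Finset.card_insert_of_notMem hxR, hRk], hinf⟩
    have := Nat.le_findGreatest (hb _ hP).le hP
    omega
  · rintro A ⟨hA, hRA⟩
    obtain ⟨x, hx, hxF⟩ := Finset.not_disjoint_iff.mp (hcon A hA hRA)
    rw [Finset.mem_sdiff] at hx
    simp only [Set.mem_iUnion]
    exact ⟨x, Finset.mem_sdiff.mpr ⟨hxF, hx.2⟩, hA, Finset.insert_subset hx.1 hRA⟩

/-- The Claim: let `Φ : C_p(X) → C_p(Y)` be a continuous open surjection taking the
zero function to the zero function, let `m, n ≥ 1` and `y ∈ Y`.  If there is no finite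
set `A ⊆ X` with `|A| ≤ n - 1` and `Φ(O_X(A; 1/m)) ⊆ Ō_Y(y; 1)`, then the collection
of finite sets `A ⊆ X` with `|A| ≤ n` and `Φ(O_X(A; 1/m)) ⊆ Ō_Y(y; 1)` is finite. -/
theorem claim_finitely_many_witnesses {X Y : Type*}
    [TopologicalSpace X] [TopologicalSpace Y] [T35Space X] [T35Space Y]
    (Φ : Cp X → Cp Y) (hcont : Continuous Φ) (hopen : IsOpenMap Φ)
    (hsurj : Function.Surjective Φ)
    (hzero : Φ ⟨fun _ => (0 : ℝ), continuous_const⟩ = ⟨fun _ => (0 : ℝ), continuous_const⟩)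
    (m n : ℕ) (hm : 1 ≤ m) (hn : 1 ≤ n) (y : Y)
    (hno : ¬ ∃ A : Finset X, A.card ≤ n - 1 ∧
      ∀ f : Cp X, (∀ x ∈ A, |f.1 x| < 1 / (m : ℝ)) → |(Φ f).1 y| ≤ 1) :
    {A : Finset X | A.card ≤ n ∧
      ∀ f : Cp X, (∀ x ∈ A, |f.1 x| < 1 / (m : ℝ)) → |(Φ f).1 y| ≤ 1}.Finite := by
  classical
  by_contra hinf
  obtain ⟨R, hRn, hR⟩ := cp_root _ n (fun A hA => hA.1) hinf
  refine hno ⟨R, by omega, fun f hf => ?_⟩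
  by_contra hgt
  have hev : Continuous fun f : Cp X => |(Φ f).1 y| :=
    ((continuous_apply y).comp (continuous_subtype_val.comp hcont)).abs
  have hU : IsOpen {f : Cp X | 1 < |(Φ f).1 y|} := isOpen_lt continuous_const hev
  obtain ⟨V, hV, hVU⟩ := isOpen_induced_iff.mp hU
  have hfV : f.1 ∈ V := by
    have : f ∈ {f : Cp X | 1 < |(Φ f).1 y|} := not_le.mp hgt
    rw [← hVU] at this
    exact this
  obtain ⟨I, u, hu, hIV⟩ := isOpen_pi_iff.mp hV f.1 hfV
  obtain ⟨A, hA, hRA, hd⟩ := hR I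
  obtain ⟨g, hg, h0, h1⟩ := cp_separate (A \ R) (I ∪ R)
    (Finset.disjoint_union_right.mpr ⟨hd, Finset.sdiff_disjoint⟩)
  let p : Cp X := ⟨fun x => f.1 x * g x, f.2.mul hg⟩
  have hpV : p.1 ∈ V := by
    refine hIV fun x hx => ?_
    have : g x = 1 := h1 x (Finset.mem_union_left _ hx)
    simpa [p, this] using (hu x hx).2
  have hp : 1 < |(Φ p).1 y| := by
    have : p ∈ {f : Cp X | 1 < |(Φ f).1 y|} := by
      rw [← hVU]
      exact hpV
    exact this
  refine absurd (hA.2 p fun x hx => ?_) (not_le.mpr hp)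
  by_cases hxR : x ∈ R
  · have : g x = 1 := h1 x (Finset.mem_union_right _ hxR)
    simpa [p, this] using hf x hxR
  · have : g x = 0 := h0 x (Finset.mem_sdiff.mpr ⟨hx, hxR⟩)
    have hm' : (0 : ℝ) < m := by exact_mod_cast hm
    simpa [p, this] using hm'
end

section
/- Let X and Y be Tychonoff spaces, let κ be an infinite cardinal, and suppose there is a continuous open surjection from C_p(X) onto C_p(Y). If X is κ-discrete, then Y is κ-discrete. -/
/-- A space is `κ`-discrete if it is the union of at most `κ` many subspaces, each of
which is discrete in its subspace topology. -/
def KappaDiscrete (κ : Cardinal.{u}) (X : Type u) [TopologicalSpace X] : Prop :=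
  ∃ 𝒮 : Set (Set X), Cardinal.mk 𝒮 ≤ κ ∧ ⋃₀ 𝒮 = Set.univ ∧
    ∀ S ∈ 𝒮, DiscreteTopology ↥S

open Set Filter Topology

theorem Cp.nhds_basic {X : Type*} [TopologicalSpace X] (f : Cp X) (U : Set (Cp X))
    (hU : IsOpen U) (hf : f ∈ U) :
    ∃ F : Finset X, ∀ h : Cp X, (∀ x ∈ F, h.1 x = f.1 x) → h ∈ U := by
  obtain ⟨V, hV, rfl⟩ := isOpen_induced_iff.1 hU
  obtain ⟨F, u, hu, hsub⟩ := isOpen_pi_iff.1 hV f.1 hf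
  refine ⟨F, fun h hh => hsub ?_⟩
  intro x hx
  rw [hh x hx]
  exact (hu x hx).2

theorem Cp.continuous_eval {X : Type*} [TopologicalSpace X] (x : X) :
    Continuous (fun f : Cp X => f.1 x) :=
  (continuous_apply x).comp continuous_subtype_val

theorem lemB {Y M I : Type*} [TopologicalSpace Y] [TopologicalSpace M] [T1Space Y] [T1Space M]
    (E : Set Y) (K : Y → Set M) (D : I → Set M)
    (hfin : ∀ y ∈ E, (K y).Finite) (hne : ∀ y ∈ E, (K y).Nonempty)
    (hcov : ∀ y ∈ E, ∀ k ∈ K y, ∃ τ, k ∈ D τ)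
    (hD : ∀ τ, ∀ p ∈ D τ, ∃ U, IsOpen U ∧ p ∈ U ∧ ∀ q ∈ U, q ∈ D τ → q = p)
    (husc : ∀ W, IsOpen W → IsOpen {y | K y ⊆ W})
    (hfin' : ∀ y ∈ E, ∀ k ∈ K y, {y' | k ∈ K y'}.Finite) :
    ∃ s : Y → Finset I × ℕ, ∀ y ∈ E, ∃ V, IsOpen V ∧ y ∈ V ∧
      ∀ y' ∈ V, y' ∈ E → s y' = s y → y' = y := by
  classical
  let c : Finset I → M → ℕ := fun T p => (T.filter (fun τ => p ∈ closure (D τ))).card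
  have hT : ∀ y, ∃ T : Finset I, y ∈ E → ∀ k ∈ K y, ∃ τ ∈ T, k ∈ D τ := by
    intro y
    by_cases hy : y ∈ E
    · have : ∀ k : M, ∃ τ : Option I, k ∈ K y → ∃ t, τ = some t ∧ k ∈ D t := by
        intro k
        by_cases hk : k ∈ K y
        · obtain ⟨t, ht⟩ := hcov y hy k hk
          exact ⟨some t, fun _ => ⟨t, rfl, ht⟩⟩
        · exact ⟨none, fun h => absurd h hk⟩
      choose g hg using this
      refine ⟨((hfin y hy).toFinset.image g).eraseNone, fun _ k hk => ?_⟩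
      obtain ⟨t, h1, h2⟩ := hg k hk
      refine ⟨t, ?_, h2⟩
      rw [Finset.mem_eraseNone, Finset.mem_image]
      exact ⟨k, by simpa using hk, h1⟩
    · exact ⟨∅, fun h => absurd h hy⟩
  choose T hT using hT
  have hr : ∀ y, ∃ r : ℕ, y ∈ E → (∃ p ∈ K y, c (T y) p = r) ∧ ∀ p ∈ K y, c (T y) p ≤ r := by
    intro y
    by_cases hy : y ∈ E
    · obtain ⟨p, hp, hmax⟩ := (hfin y hy).exists_maximalFor (c (T y)) _ (hne y hy)
      refine ⟨c (T y) p, fun _ => ⟨⟨p, hp, rfl⟩, fun q hq => ?_⟩⟩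
      by_contra hcon
      exact hcon (hmax hq (le_of_not_ge hcon))
    · exact ⟨0, fun h => absurd h hy⟩
  choose r hr using hr
  refine ⟨fun y => (T y, r y), fun y hy => ?_⟩
  have hU : ∀ p, ∃ U, IsOpen U ∧ (p ∈ K y → p ∈ U ∧ ∃ τ ∈ T y, p ∈ D τ ∧
      ∀ q ∈ U, q ∈ closure (D τ) → q = p) := by
    intro p
    by_cases hp : p ∈ K y
    · obtain ⟨τ, hτ, hpτ⟩ := hT y hy p hp
      obtain ⟨U, hUo, hpU, hU⟩ := hD τ p hpτ
      refine ⟨U, hUo, fun _ => ⟨hpU, τ, hτ, hpτ, fun q hq hqc => ?_⟩⟩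
      by_contra hne
      obtain ⟨z, ⟨hz1, hz2⟩, hz3⟩ := mem_closure_iff.1 hqc (U ∩ {p}ᶜ)
        (hUo.inter isOpen_compl_singleton) ⟨hq, hne⟩
      exact hz2 (hU z hz1 hz3)
    · exact ⟨univ, isOpen_univ, fun h => absurd h hp⟩
  choose U hUo hU using hU
  let W : M → Set M := fun p => U p ∩ ⋂ τ ∈ (T y).filter (fun τ => p ∉ closure (D τ)),
    (closure (D τ))ᶜ
  have hWo : ∀ p, IsOpen (W p) := fun p => (hUo p).inter
    (isOpen_biInter_finset fun τ _ => isClosed_closure.isOpen_compl)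
  let B : Set Y := (⋃ p ∈ K y, {y' | p ∈ K y'}) \ {y}
  have hB : B.Finite := ((hfin y hy).biUnion (fun p hp => hfin' y hy p hp)).subset sdiff_subset
  refine ⟨{y' | K y' ⊆ ⋃ p ∈ K y, W p} ∩ Bᶜ,
    (husc _ (isOpen_biUnion fun p _ => hWo p)).inter hB.isClosed.isOpen_compl, ⟨?_, ?_⟩, ?_⟩
  · intro p hp
    refine mem_biUnion hp ⟨(hU p hp).1, ?_⟩
    simp only [mem_iInter, Finset.mem_filter]
    exact fun τ h => h.2
  · exact fun h => h.2 rfl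
  · rintro y' ⟨h1, h2⟩ hy' hs
    have hs1 : T y' = T y := congrArg Prod.fst hs
    have hs2 : r y' = r y := congrArg Prod.snd hs
    obtain ⟨⟨p', hp', hcp'⟩, -⟩ := hr y' hy'
    obtain ⟨p, hp, hpW⟩ := mem_iUnion₂.1 (h1 hp')
    rw [hs1, hs2] at hcp'
    have hcp := (hr y hy).2 p hp
    have hsub : (T y).filter (fun τ => p' ∈ closure (D τ)) ⊆
        (T y).filter (fun τ => p ∈ closure (D τ)) := by
      intro τ hτ
      rw [Finset.mem_filter] at hτ ⊢
      refine ⟨hτ.1, ?_⟩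
      by_contra hcon
      have := hpW.2
      simp only [mem_iInter, Finset.mem_filter] at this
      exact this τ ⟨hτ.1, hcon⟩ hτ.2
    have heq := Finset.eq_of_subset_of_card_le hsub (by
      change c (T y) p ≤ c (T y) p'
      omega)
    obtain ⟨-, τ, hτ, hpτ, hq⟩ := hU p hp
    have : τ ∈ (T y).filter (fun τ => p' ∈ closure (D τ)) := by
      rw [heq, Finset.mem_filter]
      exact ⟨hτ, subset_closure hpτ⟩
    have hpp : p' = p := hq p' hpW.1 (Finset.mem_filter.1 this).2
    by_contra hne
    exact h2 ⟨mem_biUnion hp (by simpa [← hpp] using hp'), hne⟩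

section main

variable {X Y B : Type*} [TopologicalSpace X] [TopologicalSpace Y] [TopologicalSpace B]

/-- `f` is eventually smaller than `ε` near the point `z` of the compactification. -/
def SmallAt (e : X → B) (ε : ℝ) (f : Cp X) (z : B) : Prop :=
  ∀ᶠ x in comap e (𝓝 z), |f.1 x| < ε

def zeroCp (X : Type*) [TopologicalSpace X] : Cp X := ⟨fun _ => 0, continuous_const⟩

def ValidK (e : X → B) (Φ : Cp X → Cp Y) (ε : ℝ) (y : Y) (K : Set B) : Prop :=
  ∀ f : Cp X, (∀ z ∈ K, SmallAt e ε f z) → |(Φ f).1 y - (Φ (zeroCp X)).1 y| ≤ 1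

theorem isOpen_smallAt (e : X → B) (ε : ℝ) (f : Cp X) : IsOpen {z | SmallAt e ε f z} := by
  rw [isOpen_iff_mem_nhds]
  intro z hz
  obtain ⟨U, hU, hsub⟩ := hz
  filter_upwards [eventually_mem_nhds_iff.2 hU] with w hw
  exact ⟨U, hw, hsub⟩

theorem smallAt_iff {e : X → B} (he : IsInducing e) (ε : ℝ) (f : Cp X) (x : X) :
    SmallAt e ε f (e x) ↔ |f.1 x| < ε := by
  unfold SmallAt
  rw [← he.nhds_eq_comap]
  constructor
  · exact fun h => h.self_of_nhds
  · intro h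
    exact (f.2.abs.tendsto x).eventually (gt_mem_nhds h)

theorem valid_density [CompactSpace B] [T2Space B] {e : X → B} (he : IsEmbedding e)
    {Φ : Cp X → Cp Y} (hΦ : Continuous Φ) {ε : ℝ} (hε : 0 < ε) {y : Y} {R : Set B}
    (hR : ∀ F : Finset X, ∃ K : Set B, K.Finite ∧ ValidK e Φ ε y K ∧ K ∩ e '' F ⊆ R) :
    ValidK e Φ ε y R := by
  intro f hf
  by_contra hcon
  rw [not_le] at hcon
  have hcont : Continuous fun h : Cp X => |(Φ h).1 y - (Φ (zeroCp X)).1 y| :=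
    (((Cp.continuous_eval y).comp hΦ).sub continuous_const).abs
  obtain ⟨F, hF⟩ := Cp.nhds_basic f _ (isOpen_Ioi.preimage hcont) (show f ∈ _ from hcon)
  obtain ⟨K, hK, hKv, hKF⟩ := hR F
  have hFfin : (e '' (F : Set X)).Finite := F.finite_toSet.image e
  obtain ⟨φ, hφ0, hφ1, hφ⟩ := exists_continuous_zero_one_of_isClosed
    (s := K \ e '' F) (t := e '' F) (hK.subset sdiff_subset).isClosed hFfin.isClosed
    disjoint_sdiff_left
  let h : Cp X := ⟨fun x => f.1 x * max 0 (2 * φ (e x) - 1), f.2.mul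
    (continuous_const.max ((continuous_const.mul (φ.continuous.comp he.continuous)).sub
      continuous_const))⟩
  have h1 := hF h (by
    intro x hx
    have : φ (e x) = 1 := hφ1 (mem_image_of_mem e hx)
    simp only [h, this]
    norm_num)
  refine absurd (hKv h ?_) (not_le.2 h1)
  intro z hz
  by_cases hzF : z ∈ e '' F
  · have := hf z (hKF ⟨hz, hzF⟩)
    refine this.mono fun x hx => lt_of_le_of_lt ?_ hx
    simp only [h, abs_mul]
    refine mul_le_of_le_one_right (abs_nonneg _) ?_
    have := (hφ (e x)).2
    rw [abs_of_nonneg (le_max_left _ _)]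
    exact max_le (by norm_num) (by linarith)
  · have h0 : φ z = 0 := hφ0 ⟨hz, hzF⟩
    have : ∀ᶠ w in 𝓝 z, φ w < 1 / 2 :=
      (φ.continuous.tendsto z).eventually (gt_mem_nhds (by rw [h0]; norm_num))
    refine (this.comap e).mono fun x hx => ?_
    have : max 0 (2 * φ (e x) - 1) = 0 := max_eq_left (by linarith)
    simp only [h, this]
    simpa using hε

theorem isOpen_usc [CompactSpace B] (e : X → B) (Φ : Cp X → Cp Y) (ε : ℝ) (m : ℕ)
    (W : Set (Fin m → B)) (hW : IsOpen W) :
    IsOpen {y | {k : Fin m → B | ValidK e Φ ε y (range k)} ⊆ W} := by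
  have hZ : IsClosed {q : (Fin m → B) × Y | ValidK e Φ ε q.2 (range q.1)} := by
    simp only [ValidK, ofPred_forall]
    refine isClosed_iInter fun f => ?_
    have : ∀ q : (Fin m → B) × Y, ((∀ z ∈ range q.1, SmallAt e ε f z) →
        |(Φ f).1 q.2 - (Φ (zeroCp X)).1 q.2| ≤ 1) ↔
        (q ∈ {q : (Fin m → B) × Y | ∀ i, SmallAt e ε f (q.1 i)}ᶜ ∪
          {q : (Fin m → B) × Y | |(Φ f).1 q.2 - (Φ (zeroCp X)).1 q.2| ≤ 1}) := by
      intro q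
      simp only [forall_mem_range, mem_union, mem_compl_iff, mem_ofPred_eq]
      exact imp_iff_not_or
    have h2 : IsClosed ({q : (Fin m → B) × Y | ∀ i, SmallAt e ε f (q.1 i)}ᶜ ∪
          {q : (Fin m → B) × Y | |(Φ f).1 q.2 - (Φ (zeroCp X)).1 q.2| ≤ 1}) := by
      refine IsClosed.union ?_ ?_
      · rw [isClosed_compl_iff, ofPred_forall]
        refine isOpen_iInter_of_finite fun i => ?_
        have hc : Continuous fun q : (Fin m → B) × Y => q.1 i :=
          (continuous_apply i).comp continuous_fst
        exact (isOpen_smallAt e ε f).preimage hc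
      · exact isClosed_le ((((Φ f).2.comp continuous_snd).sub
          ((Φ (zeroCp X)).2.comp continuous_snd)).abs) continuous_const
    convert h2 using 1
    ext q
    rw [← this q]
    rfl
  have h3 := isClosedMap_snd_of_compactSpace _ (hZ.inter (hW.isClosed_compl.preimage continuous_fst))
  convert h3.isOpen_compl using 1
  ext y
  simp only [mem_ofPred_eq, mem_compl_iff, mem_image, Prod.exists, not_exists]
  constructor
  · rintro h k y' ⟨⟨h1, h2⟩, rfl⟩
    exact h2 (h h1)
  · intro h k hk
    by_contra hc
    exact h k y ⟨⟨hk, hc⟩, rfl⟩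

theorem finite_y [T35Space Y] {e : X → B} (he : IsInducing e)
    {Φ : Cp X → Cp Y} (hΦ : IsOpenMap Φ) {ε : ℝ} (hε : 0 < ε) (K : Set B) (hK : K.Finite)
    (hKX : K ⊆ range e) : {y | ValidK e Φ ε y K}.Finite := by
  let O : Set (Cp X) := ⋂ z ∈ K, {f | SmallAt e ε f z}
  have hO : IsOpen O := by
    refine hK.isOpen_biInter fun z hz => ?_
    obtain ⟨x, rfl⟩ := hKX hz
    simp only [smallAt_iff he]
    exact isOpen_lt (Cp.continuous_eval x).abs continuous_const
  have h0 : zeroCp X ∈ O := by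
    refine mem_iInter₂.2 fun z hz => ?_
    obtain ⟨x, rfl⟩ := hKX hz
    refine (smallAt_iff he ε _ x).2 ?_
    simpa [zeroCp] using hε
  obtain ⟨L, hL⟩ := Cp.nhds_basic (Φ (zeroCp X)) (Φ '' O) (hΦ O hO) (mem_image_of_mem _ h0)
  refine L.finite_toSet.subset fun y hy => ?_
  by_contra hyL
  obtain ⟨g, hg, hgy, hgL⟩ := CompletelyRegularSpace.completely_regular y (L : Set Y)
    L.finite_toSet.isClosed hyL
  have hg' : Continuous fun y => (g y : ℝ) := continuous_subtype_val.comp hg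
  obtain ⟨f, hf, hfeq⟩ := hL ⟨fun z => (Φ (zeroCp X)).1 z + 2 * (1 - g z),
    (Φ (zeroCp X)).2.add (continuous_const.mul (continuous_const.sub hg'))⟩ (by
      intro x hx
      have : g x = 1 := hgL hx
      simp [this])
  have := hy f (fun z hz => mem_iInter₂.1 hf z hz)
  rw [hfeq] at this
  simp only [hgy] at this
  norm_num at this

theorem exists_valid {e : X → B} (he : IsInducing e)
    {Φ : Cp X → Cp Y} (hΦ : Continuous Φ) (y : Y) :
    ∃ n : ℕ, ∃ K : Finset B, ValidK e Φ (1 / ((n : ℝ) + 1)) y K := by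
  classical
  have hcont : Continuous fun h : Cp X => |(Φ h).1 y - (Φ (zeroCp X)).1 y| :=
    (((Cp.continuous_eval y).comp hΦ).sub continuous_const).abs
  have hO := (isOpen_Iio (a := (1 : ℝ))).preimage hcont
  obtain ⟨V, hV, hVO⟩ := isOpen_induced_iff.1 hO
  have h0 : zeroCp X ∈ (Subtype.val ⁻¹' V : Set (Cp X)) := by
    rw [hVO]; simp
  obtain ⟨F, u, hu, hsub⟩ := isOpen_pi_iff.1 hV (zeroCp X).1 h0
  have : ∀ᶠ δ in 𝓝[>] (0 : ℝ), ∀ x ∈ F, Metric.ball (0 : ℝ) δ ⊆ u x := by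
    rw [Filter.eventually_all_finset]
    intro x hx
    obtain ⟨δ, hδ, hb⟩ := Metric.isOpen_iff.1 (hu x hx).1 0 (hu x hx).2
    filter_upwards [Ioo_mem_nhdsGT hδ] with r hr
    exact (Metric.ball_subset_ball hr.2.le).trans hb
  obtain ⟨n, hn⟩ := ((tendsto_nhdsWithin_iff.2
      ⟨tendsto_one_div_add_atTop_nhds_zero_nat (𝕜 := ℝ), Eventually.of_forall fun n => by
        simp only [mem_Ioi]; positivity⟩).eventually this).exists
  refine ⟨n, F.image e, fun f hf => ?_⟩
  have : f ∈ (Subtype.val ⁻¹' V : Set (Cp X)) := by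
    refine hsub fun x hx => hn x hx ?_
    have := hf (e x) (by simpa using ⟨x, hx, rfl⟩)
    rw [smallAt_iff he] at this
    simpa using this
  rw [hVO] at this
  exact le_of_lt this

theorem valid_subset_range [CompactSpace B] [T2Space B] {e : X → B} (he : IsEmbedding e)
    {Φ : Cp X → Cp Y} (hΦ : Continuous Φ) {ε : ℝ} (hε : 0 < ε) {y : Y} {m : ℕ}
    (hm : ∀ K : Finset B, ValidK e Φ ε y K → m ≤ K.card)
    (K : Finset B) (hK : ValidK e Φ ε y K) (hKm : K.card ≤ m) : (K : Set B) ⊆ range e := by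
  classical
  have h : ValidK e Φ ε y (K.filter (· ∈ range e) : Finset B) := by
    refine valid_density he hΦ hε fun F => ⟨K, K.finite_toSet, hK, ?_⟩
    rintro z ⟨hz, x, -, rfl⟩
    simpa using hz
  have := hm _ h
  have h2 := Finset.eq_of_subset_of_card_le (Finset.filter_subset (· ∈ range e) K) (by omega)
  intro z hz
  rw [← h2] at hz
  exact (Finset.mem_filter.1 hz).2

theorem valid_finite [CompactSpace B] [T2Space B] {e : X → B} (he : IsEmbedding e)
    {Φ : Cp X → Cp Y} (hΦ : Continuous Φ) {ε : ℝ} (hε : 0 < ε) {y : Y} {m : ℕ}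
    (hm : ∀ K : Finset B, ValidK e Φ ε y K → m ≤ K.card) :
    {K : Finset B | ValidK e Φ ε y K ∧ K.card ≤ m}.Finite := by
  classical
  by_contra hinf
  set A := {K : Finset B | ValidK e Φ ε y K ∧ K.card ≤ m} with hA
  let P : ℕ → Prop := fun j => ∃ R : Finset B, R.card = j ∧ {K ∈ A | R ⊆ K}.Infinite
  have hP0 : P 0 := ⟨∅, rfl, by simpa using hinf⟩
  have hPb : ∀ j, P j → j < m := by
    rintro j ⟨R, rfl, hR⟩
    by_contra hj
    refine hR ((finite_singleton R).subset ?_)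
    rintro K ⟨hK, hRK⟩
    exact (Finset.eq_of_subset_of_card_le hRK (hK.2.trans (not_lt.1 hj))).symm
  obtain ⟨R, hRc, hR⟩ : P (Nat.findGreatest P m) := Nat.findGreatest_spec (Nat.zero_le m) hP0
  have hv : ValidK e Φ ε y R := by
    refine valid_density he hΦ hε fun F => ?_
    have hbad : (⋃ z ∈ (F.image e).filter (· ∉ R), {K ∈ A | insert z R ⊆ K}).Finite := by
      refine (Finset.finite_toSet _).biUnion fun z hz => ?_
      by_contra hcon
      have hz' := (Finset.mem_filter.1 hz).2
      have hP : P (Nat.findGreatest P m + 1) :=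
        ⟨insert z R, by rw [Finset.card_insert_of_notMem hz', hRc], hcon⟩
      have := Nat.le_findGreatest (hPb _ hP).le hP
      omega
    obtain ⟨K, ⟨hKA, hRK⟩, hK⟩ := (hR.sdiff hbad).nonempty
    refine ⟨K, K.finite_toSet, hKA.1, ?_⟩
    rintro z ⟨hz, hzF⟩
    by_contra hzR
    refine hK (mem_biUnion (x := z) ?_ ⟨hKA, Finset.insert_subset hz hRK⟩)
    simp only [Finset.coe_filter, mem_ofPred_eq, Finset.mem_image]
    exact ⟨by simpa using hzF, hzR⟩
  have h1 := hm R hv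
  have h2 := hPb _ ⟨R, hRc, hR⟩
  omega

theorem lemC [CompactSpace B] [T2Space B] [T35Space Y] {e : X → B} (he : IsEmbedding e)
    {Φ : Cp X → Cp Y} (hΦ : Continuous Φ) (hΦo : IsOpenMap Φ) {ι : Type*} (t : X → ι)
    (ht : ∀ x, ∃ U, IsOpen U ∧ x ∈ U ∧ ∀ x' ∈ U, t x' = t x → x' = x)
    {ε : ℝ} (hε : 0 < ε) (m : ℕ) (E : Set Y)
    (hE1 : ∀ y ∈ E, ∃ K : Finset B, ValidK e Φ ε y K ∧ K.card = m)
    (hE2 : ∀ y ∈ E, ∀ K : Finset B, ValidK e Φ ε y K → m ≤ K.card) :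
    ∃ s : Y → Finset (List ι) × ℕ, ∀ y ∈ E, ∃ V, IsOpen V ∧ y ∈ V ∧
      ∀ y' ∈ V, y' ∈ E → s y' = s y → y' = y := by
  classical
  have hco : ∀ k : Fin m → B, ((Finset.univ.image k : Finset B) : Set B) = range k := by
    intro k; simp
  have hcard : ∀ k : Fin m → B, (Finset.univ.image k : Finset B).card ≤ m := by
    intro k; simpa using Finset.card_image_le (s := Finset.univ) (f := k)
  have hrange : ∀ y ∈ E, ∀ k : Fin m → B, ValidK e Φ ε y (range k) → range k ⊆ range e := by
    intro y hy k hk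
    rw [← hco] at hk ⊢
    exact valid_subset_range he hΦ hε (hE2 y hy) _ hk (hcard k)
  refine lemB E (fun y => {k : Fin m → B | ValidK e Φ ε y (range k)})
    (fun l => {k | ∃ x : Fin m → X, k = e ∘ x ∧ List.ofFn (t ∘ x) = l}) ?_ ?_ ?_ ?_ ?_ ?_
  · intro y hy
    refine Finite.subset ((valid_finite he hΦ hε (hE2 y hy)).biUnion
      (t := fun K => {k : Fin m → B | ∀ i, k i ∈ (K : Set B)}) fun K _ => ?_) ?_
    · have := Set.Finite.pi' (ι := Fin m) (t := fun _ => (K : Set B)) (fun _ => K.finite_toSet)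
      exact this
    · intro k hk
      refine mem_biUnion (x := Finset.univ.image k) ⟨by rw [hco]; exact hk, hcard k⟩ ?_
      intro i
      rw [hco]; exact mem_range_self i
  · intro y hy
    obtain ⟨K, hK, hc⟩ := hE1 y hy
    refine ⟨fun i => ((K.equivFinOfCardEq hc).symm i : B), ?_⟩
    have : range (fun i => ((K.equivFinOfCardEq hc).symm i : B)) = K := by
      ext z
      constructor
      · rintro ⟨i, rfl⟩
        exact ((K.equivFinOfCardEq hc).symm i).2
      · intro hz
        exact ⟨K.equivFinOfCardEq hc ⟨z, hz⟩, by simp⟩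
    simp only [mem_ofPred_eq]
    rw [this]; exact hK
  · intro y hy k hk
    have : ∀ i, ∃ x, e x = k i := fun i => hrange y hy k hk (mem_range_self i)
    choose x hx using this
    exact ⟨_, x, (funext hx).symm, rfl⟩
  · rintro l p ⟨x, rfl, rfl⟩
    have : ∀ i, ∃ U : Set B, IsOpen U ∧ e (x i) ∈ U ∧ ∀ x', e x' ∈ U → t x' = t (x i) → x' = x i := by
      intro i
      obtain ⟨U, hU, hxU, h⟩ := ht (x i)
      obtain ⟨V, hV, rfl⟩ := he.isInducing.isOpen_iff.1 hU
      exact ⟨V, hV, hxU, h⟩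
    choose U hUo hxU hU using this
    refine ⟨{k | ∀ i, k i ∈ U i}, ?_, hxU, ?_⟩
    · rw [ofPred_forall]
      exact isOpen_iInter_of_finite fun i => (hUo i).preimage (continuous_apply i)
    · rintro q hq ⟨x', rfl, hl⟩
      have hl' := List.ofFn_injective hl
      funext i
      exact congrArg e (hU i (x' i) (hq i) (congrFun hl' i))
  · intro W hW
    exact isOpen_usc e Φ ε m W hW
  · intro y hy k hk
    exact finite_y he.isInducing hΦo hε (range k) (finite_range k) (hrange y hy k hk)

end main

/-- If there is a continuous open surjection from `C_p(X)` onto `C_p(Y)` (with `X`, `Y`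
Tychonoff) and `X` is `κ`-discrete for an infinite cardinal `κ`, then `Y` is
`κ`-discrete. -/
theorem kappa_discrete_preserved {X Y : Type u}
    [TopologicalSpace X] [TopologicalSpace Y] [T35Space X] [T35Space Y]
    (κ : Cardinal.{u}) (hκ : Cardinal.aleph0 ≤ κ)
    (hΦ : ∃ Φ : Cp X → Cp Y, Continuous Φ ∧ IsOpenMap Φ ∧ Function.Surjective Φ)
    (hX : KappaDiscrete κ X) : KappaDiscrete κ Y := by

  classical
  obtain ⟨Φ, hΦ, hΦo, -⟩ := hΦ
  obtain ⟨𝒮, hcard, hcov, hdisc⟩ := hX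
  have he : IsEmbedding (stoneCechUnit : X → StoneCech X) := isEmbedding_stoneCechUnit
  have h1 : ∀ x : X, ∃ S : 𝒮, x ∈ S.1 := by
    intro x
    have : x ∈ ⋃₀ 𝒮 := by rw [hcov]; trivial
    obtain ⟨S, hS, hx⟩ := this
    exact ⟨⟨S, hS⟩, hx⟩
  choose t0 ht0 using h1
  have hne : Nonempty (𝒮 ↪ κ.out) := by
    rw [← Cardinal.le_def, Cardinal.mk_out]; exact hcard
  obtain ⟨j⟩ := hne
  let t : X → κ.out := fun x => j (t0 x)
  have ht : ∀ x, ∃ U, IsOpen U ∧ x ∈ U ∧ ∀ x' ∈ U, t x' = t x → x' = x := by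
    intro x
    have := discreteTopology_subtype_iff'.1 (hdisc _ (t0 x).2) x (ht0 x)
    obtain ⟨U, hU, hUS⟩ := this
    have hx : x ∈ U ∩ (t0 x).1 := by rw [hUS]; rfl
    refine ⟨U, hU, hx.1, fun x' hx' htt => ?_⟩
    have h2 : t0 x' = t0 x := j.injective htt
    have : x' ∈ U ∩ (t0 x).1 := ⟨hx', h2 ▸ ht0 x'⟩
    rw [hUS] at this
    exact this
  have hmin : ∀ y : Y, ∃ n m : ℕ,
      (∃ K : Finset (StoneCech X), ValidK stoneCechUnit Φ (1 / ((n : ℝ) + 1)) y K ∧ K.card = m) ∧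
      ∀ K : Finset (StoneCech X), ValidK stoneCechUnit Φ (1 / ((n : ℝ) + 1)) y K → m ≤ K.card := by
    intro y
    obtain ⟨n, K, hK⟩ := exists_valid he.isInducing hΦ y
    have hex : ∃ m, ∃ K : Finset (StoneCech X),
        ValidK stoneCechUnit Φ (1 / ((n : ℝ) + 1)) y K ∧ K.card = m := ⟨_, K, hK, rfl⟩
    exact ⟨n, Nat.find hex, Nat.find_spec hex, fun K' hK' => Nat.find_min' hex ⟨K', hK', rfl⟩⟩
  choose n m hm1 hm2 using hmin
  have hs : ∀ a b : ℕ, ∃ s : Y → Finset (List κ.out) × ℕ,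
      ∀ y ∈ {y | n y = a ∧ m y = b}, ∃ V, IsOpen V ∧ y ∈ V ∧
      ∀ y' ∈ V, y' ∈ {y | n y = a ∧ m y = b} → s y' = s y → y' = y := by
    intro a b
    refine lemC he hΦ hΦo t ht (ε := 1 / ((a : ℝ) + 1)) (by positivity) b _ ?_ ?_
    · rintro y ⟨rfl, rfl⟩
      exact hm1 y
    · rintro y ⟨rfl, rfl⟩
      exact hm2 y
  choose s hs using hs
  let code : Y → (ℕ × ℕ) × (Finset (List κ.out) × ℕ) :=
    fun y => ((n y, m y), s (n y) (m y) y)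
  refine ⟨range fun q => code ⁻¹' {q}, ?_, ?_, ?_⟩
  · refine Cardinal.mk_range_le.trans ?_
    have : Infinite κ.out := by
      rw [Cardinal.infinite_iff, Cardinal.mk_out]; exact hκ
    have hf : Cardinal.mk (Finset (List κ.out)) = κ := by
      rw [Cardinal.mk_finset_of_infinite, Cardinal.mk_list_eq_mk, Cardinal.mk_out]
    simp only [Cardinal.mk_prod, Cardinal.lift_id, Cardinal.lift_uzero, hf, Cardinal.mk_nat,
      Cardinal.lift_aleph0, Cardinal.lift_mul, Cardinal.aleph0_mul_aleph0]
    rw [Cardinal.mul_aleph0_eq hκ, Cardinal.aleph0_mul_eq hκ]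
  · refine eq_univ_of_forall fun y => ⟨code ⁻¹' {code y}, ⟨_, rfl⟩, rfl⟩
  · rintro _ ⟨q, rfl⟩
    rw [discreteTopology_subtype_iff']
    intro y hy
    obtain ⟨V, hV, hyV, h⟩ := hs (n y) (m y) y ⟨rfl, rfl⟩
    refine ⟨V, hV, ?_⟩
    ext y'
    constructor
    · rintro ⟨hy'V, hy'⟩
      have heq : code y' = code y := Eq.trans hy' (Eq.symm hy)
      have e1 : n y' = n y := congrArg (fun q => q.1.1) heq
      have e2 : m y' = m y := congrArg (fun q => q.1.2) heq
      have e3 : s (n y') (m y') y' = s (n y) (m y) y := congrArg (fun q => q.2) heq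
      rw [e1, e2] at e3
      exact h y' hy'V ⟨e1, e2⟩ e3
    · rintro rfl
      exact ⟨hyV, hy⟩
end

section
/- Let K and L be compact metrizable spaces, let k ≥ 2 be an integer, and let f : K → L be a continuous surjection all of whose fibers f⁻¹(y) are countable. If L is a k-C-space, then K is a k-C-space. -/
/-- A topological space `Z` is a `k`-`C`-space if for every sequence `U i` of open covers
of `Z`, each consisting of at most `k` open sets, there is a sequence `V i` of families of
pairwise disjoint open sets such that each member of `V i` is contained in some member of
`U i` and `⋃ i, V i` covers `Z`. -/
def IsKCSpace (k : ℕ) (Z : Type*) [TopologicalSpace Z] : Prop :=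
  ∀ U : ℕ → Set (Set Z),
    (∀ i, (∀ s ∈ U i, IsOpen s) ∧ ⋃₀ U i = Set.univ ∧ (U i).Finite ∧ (U i).ncard ≤ k) →
    ∃ V : ℕ → Set (Set Z),
      (∀ i, (∀ s ∈ V i, IsOpen s) ∧ (V i).PairwiseDisjoint id ∧
        ∀ s ∈ V i, ∃ t ∈ U i, s ⊆ t) ∧
      ⋃₀ (⋃ i, V i) = Set.univ

/-- `G` is the union of a disjoint open family refining `U`. -/
def KCPatch {Z : Type*} [TopologicalSpace Z] (U : Set (Set Z)) (G : Set Z) : Prop :=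
  ∃ V : Set (Set Z), (∀ s ∈ V, IsOpen s) ∧ V.PairwiseDisjoint id ∧
    (∀ s ∈ V, ∃ t ∈ U, s ⊆ t) ∧ ⋃₀ V = G

theorem KCPatch.isOpen {Z : Type*} [TopologicalSpace Z] {U : Set (Set Z)} {G : Set Z}
    (h : KCPatch U G) : IsOpen G := by
  obtain ⟨V, h1, _, _, rfl⟩ := h
  exact isOpen_sUnion h1

theorem KCPatch.empty {Z : Type*} [TopologicalSpace Z] (U : Set (Set Z)) :
    KCPatch U (∅ : Set Z) := ⟨∅, by simp, by simp, by simp, by simp⟩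

theorem KCPatch.glue {Z : Type*} [TopologicalSpace Z] {U : Set (Set Z)} {ε : Type*}
    {X O : ε → Set Z} (hX : ∀ e, KCPatch U (X e)) (hO : ∀ e, IsOpen (O e))
    (hd : ∀ e e', e ≠ e' → Disjoint (O e) (O e')) :
    KCPatch U (⋃ e, X e ∩ O e) := by
  choose V h1 h2 h3 h4 using hX
  refine ⟨{t | ∃ e, ∃ v ∈ V e, t = v ∩ O e}, ?_, ?_, ?_, ?_⟩
  · rintro _ ⟨e, v, hv, rfl⟩
    exact (h1 e v hv).inter (hO e)
  · rintro _ ⟨e, v, hv, rfl⟩ _ ⟨e', v', hv', rfl⟩ hne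
    by_cases he : e = e'
    · subst he
      have : v ≠ v' := by rintro rfl; exact hne rfl
      exact (h2 e hv hv' this).mono Set.inter_subset_left Set.inter_subset_left
    · exact (hd e e' he).mono Set.inter_subset_right Set.inter_subset_right
  · rintro _ ⟨e, v, hv, rfl⟩
    obtain ⟨t, ht, hvt⟩ := h3 e v hv
    exact ⟨t, ht, Set.inter_subset_left.trans hvt⟩
  · ext z
    simp only [Set.mem_sUnion, Set.mem_ofPred_eq, Set.mem_iUnion, Set.mem_inter_iff]
    constructor
    · rintro ⟨_, ⟨e, v, hv, rfl⟩, hz⟩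
      exact ⟨e, by rw [← h4 e]; exact ⟨v, hv, hz.1⟩, hz.2⟩
    · rintro ⟨e, hz, hz'⟩
      rw [← h4 e] at hz
      obtain ⟨v, hv, hzv⟩ := hz
      exact ⟨_, ⟨e, v, hv, rfl⟩, hzv, hz'⟩

/-- Every cover by at most `k` open sets is refined by `k` disjoint families. -/
theorem KCPatch.exists_decomp {Z : Type*} [TopologicalSpace Z]
    [TopologicalSpace.MetrizableSpace Z] [Nonempty Z] {k : ℕ} {U : Set (Set Z)}
    (hU : ∀ s ∈ U, IsOpen s) (hc : ⋃₀ U = Set.univ) (hf : U.Finite) (hn : U.ncard ≤ k) :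
    ∃ G : Fin k → Set Z, (∀ e, KCPatch U (G e)) ∧ ∀ z, ∃ e, z ∈ G e := by
  classical
  letI := TopologicalSpace.metrizableSpaceMetric Z
  let F : Finset (Set Z) := hf.toFinset
  have hF : ∀ s, s ∈ F ↔ s ∈ U := fun s => by simp [F]
  have hFc : F.card ≤ k := by rwa [← Set.ncard_eq_toFinset_card U hf]
  let φ : Set Z → Z → ENNReal := fun s z => Metric.infEDist z sᶜ
  have hφ : ∀ s, Continuous (φ s) := fun s => Metric.continuous_infEDist
  have hpos : ∀ s ∈ U, ∀ z, 0 < φ s z ↔ z ∈ s := by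
    intro s hs z
    rw [pos_iff_ne_zero, Ne, ← Metric.mem_closure_iff_infEDist_zero,
      (hU s hs).isClosed_compl.closure_eq]
    simp
  let O : Finset (Set Z) → Set Z := fun A =>
    {z | ∀ a ∈ A, 0 < φ a z ∧ ∀ b ∈ F \ A, φ b z < φ a z}
  have hOo : ∀ A, IsOpen (O A) := by
    intro A
    have : O A = ⋂ a ∈ A, ({z | 0 < φ a z} ∩ ⋂ b ∈ F \ A, {z | φ b z < φ a z}) := by
      ext z; simp [O]
    rw [this]
    refine isOpen_biInter_finset fun a _ => (isOpen_lt continuous_const (hφ a)).inter ?_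
    exact isOpen_biInter_finset fun b _ => isOpen_lt (hφ b) (hφ a)
  let fam : Fin k → Set (Set Z) := fun e =>
    {t | ∃ A : Finset (Set Z), A ⊆ F ∧ A.card = e + 1 ∧ t = O A}
  refine ⟨fun e => ⋃₀ fam e, fun e => ⟨fam e, ?_, ?_, ?_, rfl⟩, ?_⟩
  · rintro _ ⟨A, _, _, rfl⟩; exact hOo A
  · rintro _ ⟨A, hA, hAc, rfl⟩ _ ⟨B, hB, hBc, rfl⟩ hne
    have hAB : A ≠ B := by rintro rfl; exact hne rfl
    have h1 : ¬ A ⊆ B := fun h => hAB (Finset.eq_of_subset_of_card_le h (by omega))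
    have h2 : ¬ B ⊆ A := fun h => hAB (Finset.eq_of_subset_of_card_le h (by omega)).symm
    obtain ⟨a, haA, haB⟩ := Finset.not_subset.1 h1
    obtain ⟨b, hbB, hbA⟩ := Finset.not_subset.1 h2
    refine Set.disjoint_left.2 fun z hz hz' => ?_
    have p := (hz a haA).2 b (by simp [hB hbB, hbA])
    have q := (hz' b hbB).2 a (by simp [hA haA, haB])
    exact lt_asymm p q
  · rintro _ ⟨A, hA, hAc, rfl⟩
    have : A.Nonempty := Finset.card_pos.1 (by omega)
    obtain ⟨a, ha⟩ := this
    have haU := (hF a).1 (hA ha)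
    exact ⟨a, haU, fun z hz => (hpos a haU z).1 (hz a ha).1⟩
  · intro z
    have hz : z ∈ ⋃₀ U := by rw [hc]; trivial
    obtain ⟨s, hs, hzs⟩ := hz
    obtain ⟨m, hm, hmax⟩ := Finset.exists_max_image F (fun s => φ s z) ⟨s, (hF s).2 hs⟩
    let A := F.filter (fun a => φ a z = φ m z)
    have hmA : m ∈ A := by simp [A, hm]
    have hApos : 0 < A.card := Finset.card_pos.2 ⟨m, hmA⟩
    have hAF : A ⊆ F := Finset.filter_subset _ _
    have hAk : A.card ≤ k := (Finset.card_le_card hAF).trans hFc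
    refine ⟨⟨A.card - 1, by omega⟩, O A, ⟨A, hAF, by simp; omega, rfl⟩, ?_⟩
    intro a ha
    have hae : φ a z = φ m z := (Finset.mem_filter.1 ha).2
    refine ⟨?_, ?_⟩
    · rw [hae]
      exact lt_of_lt_of_le ((hpos s hs z).2 hzs) (hmax s ((hF s).2 hs))
    · intro b hb
      rw [Finset.mem_sdiff] at hb
      rw [hae]
      refine lt_of_le_of_ne (hmax b hb.1) fun h => hb.2 ?_
      simp [A, hb.1, h]

/-- Indexed form of the `k`-`C` property. -/
theorem IsKCSpace.indexed {k : ℕ} {Z : Type*} [TopologicalSpace Z] (h : IsKCSpace k Z)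
    (W : ℕ → Fin k → Set Z) (hW : ∀ m e, IsOpen (W m e)) (hc : ∀ m y, ∃ e, y ∈ W m e) :
    ∃ V : ℕ → Fin k → Set Z, (∀ m e, IsOpen (V m e)) ∧ (∀ m e, V m e ⊆ W m e) ∧
      (∀ m e e', e ≠ e' → Disjoint (V m e) (V m e')) ∧ ∀ y, ∃ m e, y ∈ V m e := by
  classical
  have hpre : ∀ m, (∀ s ∈ Set.range (W m), IsOpen s) ∧ ⋃₀ Set.range (W m) = Set.univ ∧
      (Set.range (W m)).Finite ∧ (Set.range (W m)).ncard ≤ k := by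
    intro m
    refine ⟨?_, ?_, ?_, ?_⟩
    · rintro _ ⟨e, rfl⟩; exact hW m e
    · refine Set.eq_univ_of_forall fun y => ?_
      obtain ⟨e, he⟩ := hc m y
      exact ⟨_, ⟨e, rfl⟩, he⟩
    · exact Set.finite_range _
    · rw [← Set.image_univ]
      refine (Set.ncard_image_le Set.finite_univ).trans ?_
      simp [Set.ncard_univ]
  obtain ⟨V, hV, hVc⟩ := h (fun m => Set.range (W m)) hpre
  · have hch : ∀ m s, ∃ e : Option (Fin k), s ∈ V m → ∃ e', e = some e' ∧ s ⊆ W m e' := by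
      intro m s
      by_cases hs : s ∈ V m
      · obtain ⟨_, ⟨e, rfl⟩, hse⟩ := (hV m).2.2 s hs
        exact ⟨some e, fun _ => ⟨e, rfl, hse⟩⟩
      · exact ⟨none, fun h => absurd h hs⟩
    choose c hcc using hch
    refine ⟨fun m e => ⋃₀ {s | s ∈ V m ∧ c m s = some e}, ?_, ?_, ?_, ?_⟩
    · exact fun m e => isOpen_sUnion fun s hs => (hV m).1 s hs.1
    · rintro m e z ⟨s, ⟨hs, hce⟩, hz⟩
      obtain ⟨e', he', hse⟩ := hcc m s hs
      have : e = e' := by rw [hce] at he'; exact Option.some.inj he'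
      subst this
      exact hse hz
    · intro m e e' hne
      refine Set.disjoint_left.2 ?_
      rintro z ⟨s, ⟨hs, hce⟩, hz⟩ ⟨s', ⟨hs', hce'⟩, hz'⟩
      have : s ≠ s' := by
        rintro rfl
        exact hne (Option.some.inj (hce.symm.trans hce'))
      exact Set.disjoint_left.1 ((hV m).2.1 hs hs' this) hz hz'
    · intro y
      have hy : y ∈ ⋃₀ (⋃ i, V i) := by rw [hVc]; trivial
      obtain ⟨s, hs, hys⟩ := hy
      obtain ⟨m, hm⟩ := Set.mem_iUnion.1 hs
      obtain ⟨e, he, _⟩ := hcc m s hm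
      exact ⟨m, e, s, ⟨hm, he⟩, hys⟩

/-- The inductive property. -/
def KCGood {K L ι : Type*} [TopologicalSpace K] (f : K → L) (U : ℕ → Set (Set K))
    (M : ι → Set K) (σ : ℕ → ℕ) : Prop :=
  ∀ S : ι → ℕ → Set K, (∀ s i, KCPatch (U (σ i)) (S s i)) →
    ∃ y, ∀ s, ∃ z ∈ M s, f z = y ∧ ∀ i, z ∉ S s i

theorem KCGood.step {K L ι : Type*} [TopologicalSpace K] [CompactSpace K]
    [TopologicalSpace L] [T2Space L] {k : ℕ} {f : K → L} (hcont : Continuous f)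
    (hL : IsKCSpace k L) {U : ℕ → Set (Set K)} {G : ℕ → Fin k → Set K}
    (hG : ∀ j e, KCPatch (U j) (G j e)) {M : ι → Set K} (hM : ∀ s, IsClosed (M s))
    {σ : ℕ → ℕ} (h : KCGood f U M σ) :
    ∃ j, ∃ σ' : ℕ → ℕ, KCGood f U (fun p : ι × Fin k => M p.1 \ G j p.2) σ' := by
  by_contra hcon
  push Not at hcon
  have hcon' : ∀ m : ℕ, ∃ S : ι × Fin k → ℕ → Set K,
      (∀ p i, KCPatch (U (σ (Nat.pair m (i + 1)))) (S p i)) ∧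
      ∀ y, ∃ p, ∀ z ∈ M p.1 \ G (σ (Nat.pair m 0)) p.2, f z = y → ∃ i, z ∈ S p i := by
    intro m
    have := hcon (σ (Nat.pair m 0)) (fun i => σ (Nat.pair m (i + 1)))
    unfold KCGood at this
    push Not at this
    exact this
  choose S hS hS' using hcon'
  let X : ℕ → ι → Fin k → ℕ → Set K := fun m s e i =>
    Nat.casesOn i (G (σ (Nat.pair m 0)) e) (fun i => S m (s, e) i)
  have hX : ∀ m s e i, KCPatch (U (σ (Nat.pair m i))) (X m s e i) := by
    intro m s e i
    cases i with
    | zero => exact hG _ _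
    | succ i => exact hS _ _ _
  let W : ℕ → Fin k → Set L := fun m e => ⋃ s, (f '' (M s \ ⋃ i, X m s e i))ᶜ
  have hWo : ∀ m e, IsOpen (W m e) := by
    intro m e
    refine isOpen_iUnion fun s => IsClosed.isOpen_compl (self := ?_)
    refine (IsCompact.image ?_ hcont).isClosed
    exact ((hM s).sdiff (isOpen_iUnion fun i => (hX m s e i).isOpen)).isCompact
  have hWc : ∀ m y, ∃ e, y ∈ W m e := by
    intro m y
    obtain ⟨⟨s, e⟩, hp⟩ := hS' m y
    refine ⟨e, Set.mem_iUnion.2 ⟨s, ?_⟩⟩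
    rintro ⟨z, ⟨hzM, hz⟩, hzy⟩
    apply hz
    by_cases hzG : z ∈ G (σ (Nat.pair m 0)) e
    · exact Set.mem_iUnion.2 ⟨0, hzG⟩
    · obtain ⟨i, hi⟩ := hp z ⟨hzM, hzG⟩ hzy
      exact Set.mem_iUnion.2 ⟨i + 1, hi⟩
  obtain ⟨V, hVo, hVW, hVd, hVc⟩ := hL.indexed W hWo hWc
  obtain ⟨y, hy⟩ := h (fun s l => ⋃ e, X l.unpair.1 s e l.unpair.2 ∩ f ⁻¹' V l.unpair.1 e) (by
    intro s l
    refine KCPatch.glue (fun e => ?_) (fun e => (hVo _ e).preimage hcont)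
      (fun e e' hne => (hVd _ e e' hne).preimage f)
    have := hX l.unpair.1 s e l.unpair.2
    rwa [Nat.pair_unpair] at this)
  obtain ⟨m, e, hye⟩ := hVc y
  obtain ⟨s, hs⟩ := Set.mem_iUnion.1 (hVW m e hye)
  obtain ⟨z, hzM, hzy, hz⟩ := hy s
  by_cases hzX : z ∈ ⋃ i, X m s e i
  · obtain ⟨i, hi⟩ := Set.mem_iUnion.1 hzX
    apply hz (Nat.pair m i)
    simp only [Nat.unpair_pair]
    exact Set.mem_iUnion.2 ⟨e, hi, by rw [Set.mem_preimage, hzy]; exact hye⟩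
  · exact hs ⟨z, ⟨hzM, hzX⟩, hzy⟩

/-- States of the recursive construction. -/
structure KCState {K L : Type*} [TopologicalSpace K] (k : ℕ) (f : K → L)
    (U : ℕ → Set (Set K)) where
  ι : Type
  π : (ℕ → Fin k) → ι
  M : ι → Set K
  hM : ∀ s, IsClosed (M s)
  σ : ℕ → ℕ
  good : KCGood f U M σ

/-- If `K` and `L` are compact metrizable spaces, `f : K → L` is a continuous surjection
with countable fibers and `L` is a `k`-`C`-space (`k ≥ 2`), then `K` is a `k`-`C`-space. -/
theorem kC_of_countable_to_one_image {K L : Type*}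
    [TopologicalSpace K] [CompactSpace K] [TopologicalSpace.MetrizableSpace K]
    [TopologicalSpace L] [CompactSpace L] [TopologicalSpace.MetrizableSpace L]
    (k : ℕ) (hk : 2 ≤ k) (f : K → L) (hcont : Continuous f)
    (hsurj : Function.Surjective f) (hfib : ∀ y : L, (f ⁻¹' {y}).Countable)
    (hL : IsKCSpace k L) : IsKCSpace k K := by
  intro U hU
  rcases isEmpty_or_nonempty K with hK | hK
  · refine ⟨fun _ => ∅, fun i => by simp, ?_⟩
    exact Subsingleton.elim _ _
  by_contra hno
  have hGex : ∀ j, ∃ G : Fin k → Set K, (∀ e, KCPatch (U j) (G e)) ∧ ∀ z, ∃ e, z ∈ G e :=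
    fun j => KCPatch.exists_decomp (hU j).1 (hU j).2.1 (hU j).2.2.1 (hU j).2.2.2
  choose G hG hGc using hGex
  have hstart : KCGood f U (fun _ : Unit => (Set.univ : Set K)) id := by
    intro S hS
    by_contra hcon
    push Not at hcon
    choose V h1 h2 h3 h4 using fun i => hS () i
    refine hno ⟨V, fun i => ⟨h1 i, h2 i, h3 i⟩, Set.eq_univ_of_forall fun z => ?_⟩
    obtain ⟨s, hs⟩ := hcon (f z)
    obtain ⟨i, hi⟩ := hs z trivial rfl
    have hi' : z ∈ ⋃₀ V i := by rw [h4 i]; exact hi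
    obtain ⟨v, hv, hzv⟩ := hi'
    exact ⟨v, Set.mem_iUnion.2 ⟨i, hv⟩, hzv⟩
  have hstep : ∀ (n : ℕ) (A : KCState k f U), ∃ (B : KCState k f U) (j : ℕ),
      ∀ x, B.M (B.π x) = A.M (A.π x) \ G j (x n) := by
    intro n A
    obtain ⟨j, σ', hg⟩ := A.good.step hcont hL hG A.hM
    exact ⟨⟨A.ι × Fin k, fun x => (A.π x, x n), _,
      fun p => (A.hM p.1).sdiff (hG j p.2).isOpen, σ', hg⟩, j, fun x => rfl⟩
  choose nxt jn hnxt using hstep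
  let st : ℕ → KCState k f U := fun n =>
    Nat.rec ⟨Unit, fun _ => (), fun _ => Set.univ, fun _ => isClosed_univ, id, hstart⟩
      (fun n A => nxt n A) n
  let N : ℕ → (ℕ → Fin k) → Set K := fun n x => (st n).M ((st n).π x)
  have hN : ∀ n x, N (n + 1) x = N n x \ G (jn n (st n)) (x n) := fun n x => hnxt n (st n) x
  have hNc : ∀ n x, IsClosed (N n x) := fun n x => (st n).hM _
  have hNs : ∀ n x, N (n + 1) x ⊆ N n x := fun n x => by rw [hN]; exact Set.sdiff_subset
  have hT : (⋂ n, ⋂ x, f '' N n x).Nonempty := by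
    have hcl : ∀ n, IsClosed (⋂ x, f '' N n x) := fun n =>
      isClosed_iInter fun x => ((hNc n x).isCompact.image hcont).isClosed
    refine IsCompact.nonempty_iInter_of_sequence_nonempty_isCompact_isClosed _ ?_ ?_ ?_ hcl
    · exact fun n => Set.iInter_mono fun x => Set.image_mono (hNs n x)
    · intro n
      obtain ⟨y, hy⟩ := (st n).good (fun _ _ => ∅) (fun _ _ => KCPatch.empty _)
      refine ⟨y, Set.mem_iInter.2 fun x => ?_⟩
      obtain ⟨z, hz, hzy, _⟩ := hy ((st n).π x)
      exact ⟨z, hz, hzy⟩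
    · exact (hcl 0).isCompact
  obtain ⟨y, hy⟩ := hT
  obtain ⟨z, hz⟩ := (hfib y).exists_eq_range (by
    obtain ⟨w, hw⟩ := hsurj y
    exact ⟨w, hw⟩)
  choose x hx using fun n => hGc (jn n (st n)) (z n)
  have hcl : ∀ n, IsClosed (f ⁻¹' {y} ∩ N n x) := fun n =>
    (isClosed_singleton.preimage hcont).inter (hNc n x)
  have : (⋂ n, f ⁻¹' {y} ∩ N n x).Nonempty := by
    refine IsCompact.nonempty_iInter_of_sequence_nonempty_isCompact_isClosed _ ?_ ?_ ?_ hcl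
    · exact fun n => Set.inter_subset_inter_right _ (hNs n x)
    · intro n
      obtain ⟨w, hw, hwy⟩ := Set.mem_iInter.1 (Set.mem_iInter.1 hy n) x
      exact ⟨w, hwy, hw⟩
    · exact (hcl 0).isCompact
  obtain ⟨w, hw⟩ := this
  rw [Set.mem_iInter] at hw
  have hwr : w ∈ Set.range z := by rw [← hz]; exact (hw 0).1
  obtain ⟨n, rfl⟩ := hwr
  have := (hw (n + 1)).2
  rw [hN] at this
  exact this.2 (hx n)
end

section
/- Let X and Y be σ-compact metrizable spaces such that C_p(Y) is the image of C_p(X) under a continuous open mapping. If for every integer n ≥ 1 the finite power X^n is weakly infinite-dimensional, then Y is weakly infinite-dimensional. -/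
/-- A topological space `Z` is weakly infinite-dimensional (equivalently, a `2`-`C`-space)
if for every sequence `U i` of open covers of `Z`, each consisting of at most `2` open
sets, there is a sequence `V i` of families of pairwise disjoint open sets such that each
member of `V i` is contained in some member of `U i` and `⋃ i, V i` covers `Z`. -/
def IsWeaklyInfiniteDimensional (Z : Type*) [TopologicalSpace Z] : Prop :=
  ∀ U : ℕ → Set (Set Z),
    (∀ i, (∀ s ∈ U i, IsOpen s) ∧ ⋃₀ U i = Set.univ ∧ (U i).Finite ∧ (U i).ncard ≤ 2) →
    ∃ V : ℕ → Set (Set Z),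
      (∀ i, (∀ s ∈ V i, IsOpen s) ∧ (V i).PairwiseDisjoint id ∧
        ∀ s ∈ V i, ∃ t ∈ U i, s ⊆ t) ∧
      ⋃₀ (⋃ i, V i) = Set.univ

open Set Topology

def GoodSet {Y : Type*} [TopologicalSpace Y] (S : Set Y) : Prop :=
  ∀ A B : ℕ → Set Y, (∀ i, IsOpen (A i) ∧ IsOpen (B i) ∧ A i ∪ B i = univ) →
    ∃ V W : ℕ → Set Y, (∀ i, IsOpen (V i) ∧ IsOpen (W i) ∧ Disjoint (V i) (W i) ∧
      V i ⊆ A i ∧ W i ⊆ B i) ∧ S ⊆ ⋃ i, V i ∪ W i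

theorem GoodSet.mono {Y : Type*} [TopologicalSpace Y] {S T : Set Y} (h : GoodSet T)
    (hS : S ⊆ T) : GoodSet S := by
  intro A B hAB
  obtain ⟨V, W, h1, h2⟩ := h A B hAB
  exact ⟨V, W, h1, hS.trans h2⟩

theorem GoodSet.empty {Y : Type*} [TopologicalSpace Y] : GoodSet (∅ : Set Y) := by
  intro A B _
  exact ⟨fun _ => ∅, fun _ => ∅, by simp, by simp⟩

theorem GoodSet.iUnion_nat {Y : Type*} [TopologicalSpace Y] {S : ℕ → Set Y}
    (h : ∀ i, GoodSet (S i)) : GoodSet (⋃ i, S i) := by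
  intro A B hAB
  have := fun j => h j (fun k => A (Nat.pair j k)) (fun k => B (Nat.pair j k))
    (fun k => hAB _)
  choose V W h1 h2 using this
  refine ⟨fun i => V i.unpair.1 i.unpair.2, fun i => W i.unpair.1 i.unpair.2, ?_, ?_⟩
  · intro i
    have := h1 i.unpair.1 i.unpair.2
    simpa only [Nat.pair_unpair] using this
  · intro y hy
    obtain ⟨j, hj⟩ := mem_iUnion.1 hy
    obtain ⟨k, hk⟩ := mem_iUnion.1 (h2 j hj)
    refine mem_iUnion.2 ⟨Nat.pair j k, ?_⟩
    simpa only [Nat.unpair_pair] using hk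

theorem GoodSet.iUnion {Y ι : Type*} [TopologicalSpace Y] [Countable ι] {S : ι → Set Y}
    (h : ∀ i, GoodSet (S i)) : GoodSet (⋃ i, S i) := by
  cases isEmpty_or_nonempty ι
  · simpa using GoodSet.empty
  · obtain ⟨f, hf⟩ := exists_surjective_nat ι
    rw [← hf.iUnion_comp]
    exact GoodSet.iUnion_nat fun i => h _

theorem GoodSet.of_diff {Y : Type*} [TopologicalSpace Y] {S N : Set Y}
    (hN : GoodSet N) (h : ∀ O, IsOpen O → N ⊆ O → GoodSet (S \ O)) : GoodSet S := by
  intro A B hAB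
  obtain ⟨V, W, h1, h2⟩ := hN (fun k => A (2 * k)) (fun k => B (2 * k)) (fun k => hAB _)
  obtain ⟨V', W', h1', h2'⟩ := h (⋃ i, V i ∪ W i)
    (isOpen_iUnion fun i => (h1 i).1.union (h1 i).2.1) h2
    (fun k => A (2 * k + 1)) (fun k => B (2 * k + 1)) (fun k => hAB _)
  refine ⟨fun i => if i % 2 = 0 then V (i / 2) else V' (i / 2),
    fun i => if i % 2 = 0 then W (i / 2) else W' (i / 2), ?_, ?_⟩
  · intro i
    by_cases hi : i % 2 = 0
    · have := h1 (i / 2)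
      rw [show 2 * (i / 2) = i by omega] at this
      simpa only [if_pos hi] using this
    · have := h1' (i / 2)
      rw [show 2 * (i / 2) + 1 = i by omega] at this
      simpa only [if_neg hi] using this
  · intro y hy
    by_cases hO : y ∈ ⋃ i, V i ∪ W i
    · obtain ⟨k, hk⟩ := mem_iUnion.1 hO
      refine mem_iUnion.2 ⟨2 * k, ?_⟩
      simpa using hk
    · obtain ⟨k, hk⟩ := mem_iUnion.1 (h2' ⟨hy, hO⟩)
      refine mem_iUnion.2 ⟨2 * k + 1, ?_⟩
      have e1 : (2 * k + 1) / 2 = k := by omega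
      have e2 : ¬ (2 * k + 1) % 2 = 0 := by omega
      simp only [if_neg e2, e1]
      exact hk

theorem wid_of_good {Y : Type*} [TopologicalSpace Y] (h : GoodSet (univ : Set Y)) :
    IsWeaklyInfiniteDimensional Y := by
  intro U hU
  by_cases hne : ∀ i, (U i).Nonempty
  · have : ∀ i, ∃ a b, a ∈ U i ∧ b ∈ U i ∧ a ∪ b = univ := by
      intro i
      obtain ⟨_, h2, h3, h4⟩ := hU i
      obtain ⟨a, ha⟩ := hne i
      by_cases hb : ∃ b ∈ U i, b ≠ a
      · obtain ⟨b, hb, hba⟩ := hb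
        refine ⟨a, b, ha, hb, ?_⟩
        have : ({a, b} : Set (Set Y)) = U i := by
          apply Set.eq_of_subset_of_ncard_le _ _ h3
          · rintro x (rfl | rfl) <;> assumption
          · rw [Set.ncard_pair hba.symm]; exact h4
        rw [← h2, ← this, sUnion_pair]
      · push Not at hb
        refine ⟨a, a, ha, ha, ?_⟩
        rw [union_self, eq_univ_iff_forall]
        intro y
        have : y ∈ ⋃₀ U i := h2 ▸ mem_univ y
        obtain ⟨t, ht, hy⟩ := this
        rwa [hb t ht] at hy
    choose A B hA hB hAB using this
    obtain ⟨V, W, h1, h2⟩ := h A B (fun i => ⟨(hU i).1 _ (hA i), (hU i).1 _ (hB i), hAB i⟩)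
    refine ⟨fun i => {V i, W i}, fun i => ⟨?_, ?_, ?_⟩, ?_⟩
    · rintro s (rfl | rfl)
      exacts [(h1 i).1, (h1 i).2.1]
    · rintro s (rfl | rfl) t (rfl | rfl) hst
      · exact absurd rfl hst
      · exact (h1 i).2.2.1
      · exact (h1 i).2.2.1.symm
      · exact absurd rfl hst
    · rintro s (rfl | rfl)
      exacts [⟨_, hA i, (h1 i).2.2.2.1⟩, ⟨_, hB i, (h1 i).2.2.2.2⟩]
    · rw [eq_univ_iff_forall]
      intro y
      obtain ⟨i, hi⟩ := mem_iUnion.1 (h2 (mem_univ y))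
      rcases hi with hi | hi
      · exact ⟨V i, mem_iUnion.2 ⟨i, by simp⟩, hi⟩
      · exact ⟨W i, mem_iUnion.2 ⟨i, by simp⟩, hi⟩
  · push Not at hne
    obtain ⟨i, hi⟩ := hne
    have h2 := (hU i).2.1
    rw [hi, sUnion_empty] at h2
    refine ⟨fun _ => ∅, fun i => by simp, ?_⟩
    simpa using h2

theorem good_of_wid {Z : Type*} [TopologicalSpace Z] (h : IsWeaklyInfiniteDimensional Z) :
    GoodSet (univ : Set Z) := by
  intro A B hAB
  obtain ⟨V, h1, h2⟩ := h (fun i => {A i, B i}) (fun i => ⟨by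
      rintro s (rfl | rfl)
      exacts [(hAB i).1, (hAB i).2.1], by rw [sUnion_pair]; exact (hAB i).2.2,
      by simp, by
        refine (Set.ncard_insert_le _ _).trans ?_
        rw [Set.ncard_singleton]⟩)
  refine ⟨fun i => ⋃₀ {s ∈ V i | s ⊆ A i}, fun i => ⋃₀ {s ∈ V i | ¬ s ⊆ A i}, fun i => ?_, ?_⟩
  · refine ⟨isOpen_sUnion fun s hs => (h1 i).1 s hs.1,
      isOpen_sUnion fun s hs => (h1 i).1 s hs.1, ?_, ?_, ?_⟩
    · rw [Set.disjoint_left]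
      rintro x ⟨s, hs, hxs⟩ ⟨t, ht, hxt⟩
      have hst : s ≠ t := by
        rintro rfl
        exact ht.2 hs.2
      exact Set.disjoint_left.1 ((h1 i).2.1 hs.1 ht.1 hst) hxs hxt
    · exact sUnion_subset fun s hs => hs.2
    · refine sUnion_subset fun s hs => ?_
      obtain ⟨t, ht, hst⟩ := (h1 i).2.2 s hs.1
      rcases ht with rfl | rfl
      · exact absurd hst hs.2
      · exact hst
  · intro z _
    have : z ∈ ⋃₀ (⋃ i, V i) := h2 ▸ mem_univ z
    obtain ⟨s, hs, hz⟩ := this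
    obtain ⟨i, hi⟩ := mem_iUnion.1 hs
    refine mem_iUnion.2 ⟨i, ?_⟩
    by_cases hsA : s ⊆ A i
    · exact Or.inl ⟨s, ⟨hi, hsA⟩, hz⟩
    · exact Or.inr ⟨s, ⟨hi, hsA⟩, hz⟩

theorem good_of_injOn {T Y Z : Type*} [TopologicalSpace T] [TopologicalSpace Y]
    [TopologicalSpace Z] [T2Space Z] [T5Space Y] {p : T → Y} {q : T → Z}
    (hp : Continuous p) (hq : Continuous q) (hZ : GoodSet (univ : Set Z)) {C : Set T}
    (hC : IsCompact C) (ip : InjOn p C) (iq : InjOn q C) : GoodSet (p '' C) := by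
  intro A B hAB
  have hcl : ∀ D : Set Y, IsOpen D → IsClosed (q '' (C ∩ p ⁻¹' Dᶜ)) := fun D hD =>
    ((hC.inter_right (hD.isClosed_compl.preimage hp)).image hq).isClosed
  obtain ⟨V, W, h1, h2⟩ := hZ (fun i => (q '' (C ∩ p ⁻¹' (A i)ᶜ))ᶜ)
    (fun i => (q '' (C ∩ p ⁻¹' (B i)ᶜ))ᶜ) (fun i => by
      refine ⟨(hcl _ (hAB i).1).isOpen_compl, (hcl _ (hAB i).2.1).isOpen_compl, ?_⟩
      rw [← compl_inter, compl_univ_iff]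
      rw [eq_empty_iff_forall_notMem]
      rintro z ⟨⟨c, ⟨hc, hcA⟩, rfl⟩, ⟨c', ⟨hc', hcB⟩, hcc⟩⟩
      have := iq hc' hc hcc
      subst this
      have : p c' ∈ A i ∪ B i := (hAB i).2.2 ▸ mem_univ _
      exact this.elim hcA hcB)
  have key : ∀ P Q : Set Z, IsOpen P → Disjoint P Q →
      Disjoint (p '' (C ∩ q ⁻¹' P)) (closure (p '' (C ∩ q ⁻¹' Q))) := by
    intro P Q hP hPQ
    have hk : IsClosed (p '' (C ∩ q ⁻¹' Pᶜ)) :=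
      ((hC.inter_right (hP.isClosed_compl.preimage hq)).image hp).isClosed
    have hs : closure (p '' (C ∩ q ⁻¹' Q)) ⊆ p '' (C ∩ q ⁻¹' Pᶜ) := by
      apply closure_minimal _ hk
      apply image_mono
      rintro c ⟨hc, hcQ⟩
      exact ⟨hc, fun hcP => Set.disjoint_left.1 hPQ hcP hcQ⟩
    refine Disjoint.mono_right hs ?_
    rw [Set.disjoint_left]
    rintro y ⟨c, ⟨hc, hcP⟩, rfl⟩ ⟨c', ⟨hc', hcQ⟩, hcc⟩
    have := ip hc' hc hcc
    subst this
    exact hcQ hcP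
  have : ∀ i, SeparatedNhds (p '' (C ∩ q ⁻¹' V i)) (p '' (C ∩ q ⁻¹' W i)) := by
    intro i
    rw [separatedNhds_iff_disjoint]
    exact CompletelyNormalSpace.completely_normal
      (key _ _ (h1 i).2.1 (h1 i).2.2.1.symm).symm (key _ _ (h1 i).1 (h1 i).2.2.1)
  choose V' W' hV' hW' hVV hWW hd using this
  refine ⟨fun i => V' i ∩ A i, fun i => W' i ∩ B i, fun i => ⟨(hV' i).inter (hAB i).1,
    (hW' i).inter (hAB i).2.1, (hd i).mono inter_subset_left inter_subset_left,
    inter_subset_right, inter_subset_right⟩, ?_⟩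
  rintro y ⟨c, hc, rfl⟩
  obtain ⟨i, hi⟩ := mem_iUnion.1 (h2 (mem_univ (q c)))
  refine mem_iUnion.2 ⟨i, ?_⟩
  rcases hi with hi | hi
  · refine Or.inl ⟨hVV i ⟨c, ⟨hc, hi⟩, rfl⟩, ?_⟩
    by_contra hcon
    exact (h1 i).2.2.2.1 hi ⟨c, ⟨hc, hcon⟩, rfl⟩
  · refine Or.inr ⟨hWW i ⟨c, ⟨hc, hi⟩, rfl⟩, ?_⟩
    by_contra hcon
    exact (h1 i).2.2.2.2 hi ⟨c, ⟨hc, hcon⟩, rfl⟩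

theorem good_step {T Y Z : Type*} [TopologicalSpace T] [T3Space T]
    [SecondCountableTopology T] [TopologicalSpace Y]
    [TopologicalSpace Z] [T2Space Z] [T5Space Y] {p : T → Y} {q : T → Z}
    (hp : Continuous p) (hq : Continuous q) (hZ : GoodSet (univ : Set Z)) {C : Set T}
    (hC : IsCompact C) (hbad : ¬ GoodSet (p '' C)) :
    ∃ D : Set T, IsCompact D ∧ D ⊆ C ∧ ¬ GoodSet (p '' D) ∧
      ∀ d ∈ D, ∃ d' ∈ C \ D, p d' = p d ∨ q d' = q d := by
  by_contra hcon
  push Not at hcon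
  apply hbad
  let 𝓑 := TopologicalSpace.countableBasis T
  have h𝓑 := TopologicalSpace.isBasis_countableBasis T
  let ι := {b : 𝓑 × 𝓑 // Disjoint (closure (b.1 : Set T)) (closure (b.2 : Set T))}
  let D1 : ι → Set T := fun b => (closure (b.1.1 : Set T) ∩ C) ∩
    p ⁻¹' (p '' (closure (b.1.2 : Set T) ∩ C))
  let D2 : ι → Set T := fun b => (closure (b.1.1 : Set T) ∩ C) ∩
    q ⁻¹' (q '' (closure (b.1.2 : Set T) ∩ C))
  have hk : ∀ s : Set T, IsCompact (closure s ∩ C) := fun s => hC.inter_left isClosed_closure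
  haveI : Countable 𝓑 := (TopologicalSpace.countable_countableBasis T).to_subtype
  have g1 : ∀ b, GoodSet (p '' D1 b) := by
    intro b
    by_contra hb
    obtain ⟨d, hd, hd'⟩ := hcon (D1 b)
      ((hk _).inter_right ((((hk _).image hp).isClosed).preimage hp))
      (fun x hx => hx.1.2) hb
    obtain ⟨d', hd2, hdd⟩ := hd.2
    exact (hd' d' ⟨hd2.2, fun h => Set.disjoint_left.1 b.2 h.1.1 hd2.1⟩).1 hdd
  have g2 : ∀ b, GoodSet (p '' D2 b) := by
    intro b
    by_contra hb
    obtain ⟨d, hd, hd'⟩ := hcon (D2 b)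
      ((hk _).inter_right ((((hk _).image hq).isClosed).preimage hq))
      (fun x hx => hx.1.2) hb
    obtain ⟨d', hd2, hdd⟩ := hd.2
    exact (hd' d' ⟨hd2.2, fun h => Set.disjoint_left.1 b.2 h.1.1 hd2.1⟩).2 hdd
  have hN : GoodSet (⋃ b : ι ⊕ ι, Sum.elim (fun b => p '' D1 b) (fun b => p '' D2 b) b) :=
    GoodSet.iUnion (by rintro (b | b); exacts [g1 b, g2 b])
  refine GoodSet.of_diff hN fun O hO hNO => ?_
  have sep : ∀ c c' : T, c ≠ c' → ∃ b : ι, c ∈ (b.1.1 : Set T) ∧ c' ∈ (b.1.2 : Set T) := by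
    intro c c' hcc
    obtain ⟨u, hcu, hu, v, hcv, hv, huv⟩ := exists_open_nhds_disjoint_closure hcc
    obtain ⟨b, hb, hcb, hbu⟩ := h𝓑.exists_closure_subset (hu.mem_nhds hcu)
    obtain ⟨b', hb', hcb', hbv⟩ := h𝓑.exists_closure_subset (hv.mem_nhds hcv)
    exact ⟨⟨(⟨b, hb⟩, ⟨b', hb'⟩), huv.mono (hbu.trans subset_closure)
      (hbv.trans subset_closure)⟩, hcb, hcb'⟩
  have hCe : p '' C \ O = p '' (C ∩ p ⁻¹' Oᶜ) := by
    ext y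
    constructor
    · rintro ⟨⟨c, hc, rfl⟩, hy⟩
      exact ⟨c, ⟨hc, hy⟩, rfl⟩
    · rintro ⟨c, ⟨hc, hy⟩, rfl⟩
      exact ⟨⟨c, hc, rfl⟩, hy⟩
  rw [hCe]
  refine good_of_injOn hp hq hZ (hC.inter_right (hO.isClosed_compl.preimage hp)) ?_ ?_
  · intro c hc c' hc' hcc
    by_contra hne
    obtain ⟨b, hb, hb'⟩ := sep c c' hne
    exact hc.2 (hNO (mem_iUnion.2 ⟨Sum.inl b, c, ⟨⟨subset_closure hb, hc.1⟩,
      ⟨c', ⟨subset_closure hb', hc'.1⟩, hcc.symm⟩⟩, rfl⟩))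
  · intro c hc c' hc' hcc
    by_contra hne
    obtain ⟨b, hb, hb'⟩ := sep c c' hne
    exact hc.2 (hNO (mem_iUnion.2 ⟨Sum.inr b, c, ⟨⟨subset_closure hb, hc.1⟩,
      ⟨c', ⟨subset_closure hb', hc'.1⟩, hcc.symm⟩⟩, rfl⟩))

theorem good_of_finite_fibers {T Y Z : Type*} [TopologicalSpace T] [T3Space T]
    [SecondCountableTopology T] [TopologicalSpace Y]
    [TopologicalSpace Z] [T2Space Z] [T5Space Y] {p : T → Y} {q : T → Z}
    (hp : Continuous p) (hq : Continuous q) (hZ : GoodSet (univ : Set Z)) {C : Set T}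
    (hC : IsCompact C) (fp : ∀ c ∈ C, {d ∈ C | p d = p c}.Finite)
    (fq : ∀ c ∈ C, {d ∈ C | q d = q c}.Finite) : GoodSet (p '' C) := by
  by_contra hbad
  have step : ∀ D : {D : Set T // IsCompact D ∧ ¬ GoodSet (p '' D)},
      ∃ D' : {D : Set T // IsCompact D ∧ ¬ GoodSet (p '' D)}, D'.1 ⊆ D.1 ∧
        ∀ d ∈ D'.1, ∃ d' ∈ D.1 \ D'.1, p d' = p d ∨ q d' = q d := by
    rintro ⟨D, h1, h2⟩
    obtain ⟨D', a, b, c, d⟩ := good_step hp hq hZ h1 h2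
    exact ⟨⟨D', a, c⟩, b, d⟩
  choose nx hnx1 hnx2 using step
  let E : ℕ → {D : Set T // IsCompact D ∧ ¬ GoodSet (p '' D)} :=
    fun n => nx^[n] ⟨C, hC, hbad⟩
  have hE : ∀ n, E (n + 1) = nx (E n) := fun n => Function.iterate_succ_apply' _ _ _
  have hanti : Antitone fun n => (E n).1 := antitone_nat_of_succ_le fun n => by
    rw [hE]; exact hnx1 _
  obtain ⟨e, he⟩ := IsCompact.nonempty_iInter_of_sequence_nonempty_isCompact_isClosed
    (fun n => (E n).1) (fun n => hanti n.le_succ) (fun n => by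
      rw [nonempty_iff_ne_empty]
      intro h0
      apply (E n).2.2
      have h0 : (E n).1 = ∅ := h0
      rw [h0, image_empty]
      exact GoodSet.empty) hC (fun n => (E n).2.1.isClosed)
  rw [mem_iInter] at he
  have : ∀ n, ∃ d ∈ (E n).1 \ (E (n + 1)).1, p d = p e ∨ q d = q e := by
    intro n
    have := hnx2 (E n) e (by rw [← hE]; exact he _)
    rwa [← hE] at this
  choose d hd hde using this
  have heC : e ∈ C := he 0
  have hfin := (fp e heC).union (fq e heC)
  have hinj : Function.Injective d := by
    have : ∀ m n, m < n → d m ≠ d n := by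
      intro m n hmn heq
      apply (hd m).2
      rw [heq]
      exact hanti (Nat.succ_le_of_lt hmn) (hd n).1
    intro m n hmn
    by_contra hne
    rcases lt_or_gt_of_ne hne with h | h
    · exact this _ _ h hmn
    · exact this _ _ h hmn.symm
  refine Set.infinite_range_of_injective hinj (hfin.subset ?_)
  rintro _ ⟨n, rfl⟩
  have hdC : d n ∈ C := hanti (Nat.zero_le n) (hd n).1
  rcases hde n with h | h
  · exact Or.inl ⟨hdC, h⟩
  · exact Or.inr ⟨hdC, h⟩

theorem cp_open {X : Type*} [TopologicalSpace X] {O : Set (Cp X)} (hO : IsOpen O) {f : Cp X}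
    (hf : f ∈ O) : ∃ (I : Finset X) (ε : ℝ), 0 < ε ∧
      ∀ g : Cp X, (∀ x ∈ I, |g.1 x - f.1 x| < ε) → g ∈ O := by
  classical
  obtain ⟨O', hO', rfl⟩ := isOpen_induced_iff.1 hO
  obtain ⟨I, u, hu, hI⟩ := isOpen_pi_iff.1 hO' f.1 hf
  have : ∀ x, ∃ ε : ℝ, 0 < ε ∧ (x ∈ I → ∀ t, |t - f.1 x| < ε → t ∈ u x) := by
    intro x
    by_cases hx : x ∈ I
    · obtain ⟨ε, h1, h2⟩ := Metric.isOpen_iff.1 (hu x hx).1 _ (hu x hx).2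
      exact ⟨ε, h1, fun _ t ht => h2 (by simpa [Real.dist_eq] using ht)⟩
    · exact ⟨1, one_pos, fun h => absurd h hx⟩
  choose ε hε hε' using this
  have : ∃ δ : ℝ, 0 < δ ∧ ∀ x ∈ I, δ ≤ ε x := by
    clear hI hε' hu
    induction I using Finset.induction_on with
    | empty => exact ⟨1, one_pos, by simp⟩
    | insert a s _ ih =>
      obtain ⟨δ, h1, h2⟩ := ih
      refine ⟨min δ (ε a), lt_min h1 (hε a), ?_⟩
      intro x hx
      rcases Finset.mem_insert.1 hx with rfl | hx
      · exact min_le_right _ _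
      · exact (min_le_left _ _).trans (h2 x hx)
  obtain ⟨δ, hδ, hδ'⟩ := this
  refine ⟨I, δ, hδ, fun g hg => hI ?_⟩
  intro x hx
  exact hε' x hx _ ((hg x hx).trans_le (hδ' x hx))

theorem cp_eval {X : Type*} [TopologicalSpace X] (x : X) :
    Continuous fun f : Cp X => f.1 x :=
  (continuous_apply x).comp continuous_subtype_val

/-- `s` controls the value of `Φ` at `y`. -/
def Ctl {X Y : Type*} [TopologicalSpace X] [TopologicalSpace Y] (Φ : Cp X → Cp Y) (f₀ : Cp X)
    (ε : ℝ) (s : Set X) (y : Y) : Prop :=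
  ∀ f : Cp X, (∀ x ∈ s, |f.1 x| < ε) → |(Φ f).1 y - (Φ f₀).1 y| ≤ 1

/-- Continuous function one on `I`, zero on `J`. -/
theorem exists_bump {X : Type*} [TopologicalSpace X] [T4Space X] (I J : Set X)
    (hI : I.Finite) (hJ : J.Finite) (h : Disjoint I J) :
    ∃ φ : X → ℝ, Continuous φ ∧ (∀ x ∈ I, φ x = 1) ∧ ∀ x ∈ J, φ x = 0 := by
  obtain ⟨φ, h1, h2, _⟩ := exists_continuous_zero_one_of_isClosed hJ.isClosed hI.isClosed h.symm
  exact ⟨φ, φ.continuous, h2, h1⟩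

theorem finite_q {X Y : Type*} [TopologicalSpace X] [TopologicalSpace Y] [T4Space Y]
    {Φ : Cp X → Cp Y} (ho : IsOpenMap Φ) {f₀ : Cp X} (h0 : ∀ x, f₀.1 x = 0) {ε : ℝ}
    (hε : 0 < ε) {s : Set X} (hs : s.Finite) : {y | Ctl Φ f₀ ε s y}.Finite := by
  have hW : IsOpen {f : Cp X | ∀ x ∈ s, |f.1 x| < ε} := by
    have : {f : Cp X | ∀ x ∈ s, |f.1 x| < ε} = ⋂ x ∈ s, {f : Cp X | |f.1 x| < ε} := by
      ext; simp
    rw [this]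
    exact hs.isOpen_biInter fun x _ => isOpen_lt (cp_eval x).abs continuous_const
  obtain ⟨I, δ, hδ, hI⟩ := cp_open (ho _ hW) (f := Φ f₀) ⟨f₀, by simp [h0, hε], rfl⟩
  refine I.finite_toSet.subset fun y hy => ?_
  by_contra hyI
  obtain ⟨φ, hφ, h1, h2⟩ := exists_bump {y} (I : Set Y) (finite_singleton y) I.finite_toSet
    (by simpa using hyI)
  obtain ⟨f, hf, hfe⟩ := hI ⟨fun z => (Φ f₀).1 z + 2 * φ z, by
    have := (Φ f₀).2
    fun_prop⟩ (fun x hx => by simpa [h2 x hx] using hδ)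
  have := hy f hf
  rw [hfe] at this
  simp [h1 y rfl] at this

theorem delta {X : Type*} {n : ℕ} {𝒜 : Set (Fin n → X)} (h : 𝒜.Infinite) :
    ∃ (J : Finset (Fin n)) (r : Fin n → X), J ≠ Finset.univ ∧ r ∈ 𝒜 ∧
      ∀ F : Set X, F.Finite → ∃ A ∈ 𝒜, (∀ i ∈ J, A i = r i) ∧ ∀ i ∉ J, A i ∉ F := by
  classical
  let P : Finset (Fin n) → Prop := fun J => ∃ r : Fin n → X, r ∈ 𝒜 ∧
    {A ∈ 𝒜 | ∀ i ∈ J, A i = r i}.Infinite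
  have hP : P ∅ := by
    obtain ⟨r, hr⟩ := h.nonempty
    exact ⟨r, hr, by simpa using h⟩
  obtain ⟨J, -, hJ⟩ := Set.Finite.exists_le_maximal (s := {J | P J}) (Set.toFinite _) hP
  obtain ⟨r, hr, hinf⟩ := hJ.prop
  refine ⟨J, r, ?_, hr, ?_⟩
  · rintro rfl
    apply hinf
    refine (Set.finite_singleton r).subset ?_
    rintro A ⟨_, hA⟩
    exact funext fun i => hA i (Finset.mem_univ i)
  · intro F hF
    by_contra hcon
    push Not at hcon
    apply hinf
    have : ∀ i ∉ J, ∀ x, {A ∈ 𝒜 | (∀ i ∈ J, A i = r i) ∧ A i = x}.Finite := by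
      intro i hi x
      by_contra hx
      have hx : {A ∈ 𝒜 | (∀ i ∈ J, A i = r i) ∧ A i = x}.Infinite := hx
      obtain ⟨r', hr'⟩ := hx.nonempty
      have : P (insert i J) := by
        refine ⟨r', hr'.1, hx.mono ?_⟩
        rintro A ⟨hA, hAJ, hAi⟩
        refine ⟨hA, fun j hj => ?_⟩
        rcases Finset.mem_insert.1 hj with rfl | hj
        · rw [hAi, hr'.2.2]
        · rw [hAJ j hj, hr'.2.1 j hj]
      exact hi (hJ.le_of_ge this (Finset.subset_insert i J) (Finset.mem_insert_self i J))
    have hfin : (⋃ i ∈ {i | i ∉ J}, ⋃ x ∈ F,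
        {A ∈ 𝒜 | (∀ i ∈ J, A i = r i) ∧ A i = x}).Finite :=
      (Set.toFinite _).biUnion fun i hi => hF.biUnion fun x _ => this i hi x
    refine hfin.subset ?_
    rintro A ⟨hA, hAJ⟩
    obtain ⟨i, hi, hiF⟩ := hcon A hA hAJ
    simp only [mem_iUnion]
    exact ⟨i, hi, A i, hiF, hA, hAJ, rfl⟩

theorem finite_p {X Y : Type*} [TopologicalSpace X] [T4Space X] [TopologicalSpace Y]
    {Φ : Cp X → Cp Y} (hc : Continuous Φ) {f₀ : Cp X} {ε : ℝ} (hε : 0 < ε)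
    {K : Set X} {n : ℕ} {y : Y}
    (hmin : ∀ m < n, ∀ A : Fin m → X, (∀ i, A i ∈ K) → ¬ Ctl Φ f₀ ε (range A) y) :
    {A : Fin n → X | (∀ i, A i ∈ K) ∧ Ctl Φ f₀ ε (range A) y}.Finite := by
  by_contra hinf
  obtain ⟨J, r, hJ, hr, hdel⟩ := delta hinf
  have hcard : J.card < n := by
    have := Finset.card_lt_univ_of_notMem (s := J) (x := (by
      have : ∃ x, x ∉ J := by
        by_contra h
        push Not at h
        exact hJ (Finset.eq_univ_iff_forall.2 h)
      exact this.choose)) (by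
      have : ∃ x, x ∉ J := by
        by_contra h
        push Not at h
        exact hJ (Finset.eq_univ_iff_forall.2 h)
      exact this.choose_spec)
    simpa using this
  refine hmin J.card hcard (fun k => r (J.equivFin.symm k)) (fun i => hr.1 _) ?_
  intro f hf
  have hf : ∀ j ∈ J, |f.1 (r j)| < ε := fun j hj =>
    hf _ ⟨J.equivFin ⟨j, hj⟩, by simp⟩
  by_contra hbig
  rw [not_le] at hbig
  have hop : IsOpen {g : Cp X | 1 < |(Φ g).1 y - (Φ f₀).1 y|} :=
    isOpen_lt continuous_const ((((cp_eval y).comp hc).sub continuous_const).abs)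
  obtain ⟨I, δ, hδ, hI⟩ := cp_open hop hbig
  obtain ⟨A, hA, hAJ, hAF⟩ := hdel (I ∪ r '' J) (I.finite_toSet.union (J.finite_toSet.image r))
  obtain ⟨φ, hφ, h1, h2⟩ := exists_bump (I ∪ r '' J : Set X) (A '' {i | i ∉ J})
    (I.finite_toSet.union (J.finite_toSet.image r)) ((Set.toFinite _).image _) (by
      rw [Set.disjoint_right]
      rintro _ ⟨i, hi, rfl⟩
      exact hAF i hi)
  let g : Cp X := ⟨fun x => f.1 x * φ x, f.2.mul hφ⟩
  have hg1 : 1 < |(Φ g).1 y - (Φ f₀).1 y| := hI g (fun x hx => by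
    simpa [g, h1 x (Or.inl hx)] using hδ)
  refine absurd (hA.2 g ?_) (not_le.2 hg1)
  rintro _ ⟨i, rfl⟩
  by_cases hi : i ∈ J
  · have := h1 (r i) (Or.inr ⟨i, hi, rfl⟩)
    simpa [g, hAJ i hi, this] using hf i hi
  · simpa [g, h2 _ ⟨i, hi, rfl⟩] using hε

theorem ctl_closed {X Y : Type*} [TopologicalSpace X] [TopologicalSpace Y]
    (Φ : Cp X → Cp Y) (f₀ : Cp X) (ε : ℝ) (n : ℕ) :
    IsClosed {t : (Fin n → X) × Y | Ctl Φ f₀ ε (range t.1) t.2} := by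
  have : {t : (Fin n → X) × Y | Ctl Φ f₀ ε (range t.1) t.2}ᶜ =
      ⋃ f : Cp X, {t | (∀ i, |f.1 (t.1 i)| < ε) ∧ 1 < |(Φ f).1 t.2 - (Φ f₀).1 t.2|} := by
    ext t
    simp [Ctl]
  rw [← isOpen_compl_iff, this]
  refine isOpen_iUnion fun f => ?_
  have hf := f.2
  have h1 := (Φ f).2
  have h2 := (Φ f₀).2
  rw [Set.ofPred_and, Set.ofPred_forall]
  refine IsOpen.inter (isOpen_iInter_of_finite fun i => isOpen_lt ?_ ?_) (isOpen_lt ?_ ?_) <;>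
    fun_prop

/-- If `X`, `Y` are σ-compact metrizable spaces, `C_p(Y)` is the image of `C_p(X)` under
a continuous open mapping, and every finite power `X^n` (`n ≥ 1`) is weakly
infinite-dimensional, then `Y` is weakly infinite-dimensional. -/
theorem weakly_infinite_dimensional_preserved {X Y : Type*}
    [TopologicalSpace X] [SigmaCompactSpace X] [TopologicalSpace.MetrizableSpace X]
    [TopologicalSpace Y] [SigmaCompactSpace Y] [TopologicalSpace.MetrizableSpace Y]
    (hΦ : ∃ Φ : Cp X → Cp Y, Continuous Φ ∧ IsOpenMap Φ ∧ Function.Surjective Φ)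
    (hX : ∀ n : ℕ, 1 ≤ n → IsWeaklyInfiniteDimensional (Fin n → X)) :
    IsWeaklyInfiniteDimensional Y := by
  classical
  obtain ⟨Φ, hc, ho, hs⟩ := hΦ
  letI := TopologicalSpace.metrizableSpaceMetric X
  letI := TopologicalSpace.metrizableSpaceMetric Y
  haveI : SecondCountableTopology X := EMetric.secondCountable_of_sigmaCompact X
  haveI : SecondCountableTopology Y := EMetric.secondCountable_of_sigmaCompact Y
  let f₀ : Cp X := ⟨fun _ => 0, continuous_const⟩
  have h0 : ∀ x, f₀.1 x = 0 := fun _ => rfl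
  let K : ℕ → Set X := compactCovering X
  let L : ℕ → Set Y := compactCovering Y
  let S : ℕ → ℕ → ℕ → Set Y := fun m j n =>
    {y | y ∈ L j ∧ ∃ A : Fin n → X, (∀ i, A i ∈ K m) ∧ Ctl Φ f₀ (1 / (m + 1)) (range A) y}
  have hgood : ∀ m j n, GoodSet (S m j n) := by
    intro m j n
    have hε : (0 : ℝ) < 1 / (m + 1) := by positivity
    induction n using Nat.strong_induction_on with
    | _ n ih =>
    rcases Nat.eq_zero_or_pos n with rfl | hn
    · refine GoodSet.empty.mono ?_
      rintro y ⟨_, A, _, hA⟩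
      obtain ⟨f, hf⟩ := hs ⟨fun z => (Φ f₀).1 z + 2, (Φ f₀).2.add continuous_const⟩
      have := hA f (by rintro _ ⟨i, rfl⟩; exact i.elim0)
      rw [hf] at this
      norm_num at this
    · refine GoodSet.of_diff (N := ⋃ k : Fin n, S m j k) (GoodSet.iUnion fun k => ih k k.2) ?_
      intro O hO hNO
      let C : Set ((Fin n → X) × Y) := (Set.pi univ fun _ => K m) ×ˢ (L j \ O) ∩
        {t | Ctl Φ f₀ (1 / (m + 1)) (range t.1) t.2}
      have hC : IsCompact C :=
        ((isCompact_univ_pi fun _ => isCompact_compactCovering X m).prod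
          ((isCompact_compactCovering Y j).diff hO)).inter_right (ctl_closed _ _ _ _)
      refine (good_of_finite_fibers (p := Prod.snd) (q := Prod.fst) continuous_snd
        continuous_fst (good_of_wid (hX n hn)) hC ?_ ?_).mono ?_
      · rintro ⟨A, y⟩ ⟨⟨_, hy⟩, _⟩
        have := finite_p hc (f₀ := f₀) hε (K := K m) (n := n) (y := y) (by
          intro k hk B hB hBc
          exact hy.2 (hNO (mem_iUnion.2 ⟨⟨k, hk⟩, hy.1, B, hB, hBc⟩)))
        refine (this.image fun A => (A, y)).subset ?_
        rintro ⟨B, z⟩ ⟨⟨⟨hB, _⟩, hz⟩, hzy⟩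
        have hzy : z = y := hzy
        subst hzy
        exact ⟨B, ⟨fun i => hB i (mem_univ i), hz⟩, rfl⟩
      · rintro ⟨A, y⟩ _
        have := finite_q ho h0 hε (s := range A) (Set.finite_range A)
        refine (this.image fun y => (A, y)).subset ?_
        rintro ⟨B, z⟩ ⟨⟨_, hz⟩, hzy⟩
        have hzy : B = A := hzy
        subst hzy
        exact ⟨z, hz, rfl⟩
      · rintro y ⟨⟨hy, A, hA, hAc⟩, hyO⟩
        exact ⟨(A, y), ⟨⟨fun i _ => hA i, hy, hyO⟩, hAc⟩, rfl⟩
  apply wid_of_good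
  refine (GoodSet.iUnion (S := fun t : ℕ × ℕ × ℕ => S t.1 t.2.1 t.2.2)
    fun t => hgood _ _ _).mono ?_
  intro y _
  have hop : IsOpen {g : Cp X | |(Φ g).1 y - (Φ f₀).1 y| < 1} :=
    isOpen_lt ((((cp_eval y).comp hc).sub continuous_const).abs) continuous_const
  obtain ⟨I, ε, hε, hI⟩ := cp_open hop (f := f₀) (by simp)
  obtain ⟨m₁, hm₁⟩ := exists_nat_one_div_lt hε
  obtain ⟨j, hj⟩ := exists_mem_compactCovering y
  have : ∃ m₂, ∀ x ∈ I, x ∈ K m₂ := by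
    choose k hk using fun x : X => exists_mem_compactCovering x
    exact ⟨I.sup k, fun x hx => compactCovering_subset X (Finset.le_sup hx) (hk x)⟩
  obtain ⟨m₂, hm₂⟩ := this
  refine mem_iUnion.2 ⟨(max m₁ m₂, j, I.card), hj, fun k => I.equivFin.symm k, fun i =>
    compactCovering_subset X (le_max_right _ _) (hm₂ _ (I.equivFin.symm i).2), ?_⟩
  intro f hf
  refine le_of_lt (hI f fun x hx => ?_)
  have h1 := hf x ⟨I.equivFin ⟨x, hx⟩, by simp⟩
  rw [h0, sub_zero]
  refine h1.trans_le (le_trans ?_ hm₁.le)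
  apply one_div_le_one_div_of_le (by positivity)
  push_cast
  have := le_max_left (m₁ : ℝ) m₂
  linarith
end
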